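/- For every positive integer n and every permutation ω of [n], the domain D(ω) of all ω-chamber sets is w-pure, and its w-rank equals |Inv(ω)| + n + 1. -/

import Mathlib

open Finset

/-- max of a finite set of naturals, with the convention `max0 ∅ = 0`. -/
def max0 (A : Finset ℕ) : ℕ := if h : A.Nonempty then A.max' h else 0

/-- min of a finite set of naturals, with the convention `min0 ∅ = 0`. -/
def min0 (A : Finset ℕ) : ℕ := if h : A.Nonempty then A.min' h else 0

/-- `A < B` : global dominating, i.e. `max A < min B` (with `min ∅ = max ∅ = 0`). -/
def SetLT (A B : Finset ℕ) : Prop := max0 A < min0 B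

/-- `A ⋖ B` : global dominating after cancelations, i.e. `(A − B) < (B − A)`. -/
def LessDot (A B : Finset ℕ) : Prop := SetLT (A \ B) (B \ A)

/-- `A ▷ B` (splitting): `A − B ≠ ∅` and `B − A` is a union of nonempty subsets
`B′, B″` with `B′ < (A − B) < B″`. -/
def Splits (A B : Finset ℕ) : Prop :=
  (A \ B).Nonempty ∧ ∃ B' B'' : Finset ℕ, B'.Nonempty ∧ B''.Nonempty ∧
    B' ∪ B'' = B \ A ∧ SetLT B' (A \ B) ∧ SetLT (A \ B) B''

/-- `A` and `B` are strongly separated. -/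
def StronglySep (A B : Finset ℕ) : Prop := LessDot A B ∨ LessDot B A ∨ A = B

/-- `A` and `B` are weakly separated. -/
def WeaklySep (A B : Finset ℕ) : Prop :=
  StronglySep A B ∨ (Splits A B ∧ B.card ≤ A.card) ∨ (Splits B A ∧ A.card ≤ B.card)

/-- a w-collection: members are pairwise weakly separated. -/
def IsWColl (F : Finset (Finset ℕ)) : Prop := ∀ A ∈ F, ∀ B ∈ F, WeaklySep A B

/-- a maximal w-collection in the domain `D`. -/
def IsMaxWColl (D : Set (Finset ℕ)) (F : Finset (Finset ℕ)) : Prop :=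
  ↑F ⊆ D ∧ IsWColl F ∧
    ∀ G : Finset (Finset ℕ), ↑G ⊆ D → IsWColl G → F ⊆ G → F = G

/-- the domain `D` is w-pure: all maximal w-collections in `D` have the same cardinality. -/
def WPure (D : Set (Finset ℕ)) : Prop :=
  ∀ F G : Finset (Finset ℕ), IsMaxWColl D F → IsMaxWColl D G → F.card = G.card

/-- an s-collection: members are pairwise strongly separated. -/
def IsSColl (F : Finset (Finset ℕ)) : Prop := ∀ A ∈ F, ∀ B ∈ F, StronglySep A B

/-- a maximal s-collection in the domain `D`. -/
def IsMaxSColl (D : Set (Finset ℕ)) (F : Finset (Finset ℕ)) : Prop :=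
  ↑F ⊆ D ∧ IsSColl F ∧
    ∀ G : Finset (Finset ℕ), ↑G ⊆ D → IsSColl G → F ⊆ G → F = G

/-- the domain `D` is s-pure: all maximal s-collections in `D` have the same cardinality. -/
def SPure (D : Set (Finset ℕ)) : Prop :=
  ∀ F G : Finset (Finset ℕ), IsMaxSColl D F → IsMaxSColl D G → F.card = G.card

/-- the set of inversions of `ω` (as a map `[n] → [n]`). -/
def InvPairs (n : ℕ) (ω : ℕ → ℕ) : Finset (ℕ × ℕ) :=
  (Finset.Icc 1 n ×ˢ Finset.Icc 1 n).filter fun p => p.1 < p.2 ∧ ω p.2 < ω p.1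

/-- the domain `D(ω)` of all `ω`-chamber sets. -/
def ChamberDomain (n : ℕ) (ω : ℕ → ℕ) : Set (Finset ℕ) :=
  {X | X ⊆ Finset.Icc 1 n ∧
    ∀ i ∈ Finset.Icc 1 n, ∀ j ∈ Finset.Icc 1 n, i < j → ω i < ω j → j ∈ X → i ∈ X}

/-- `A ⋖ B` in the weak sense: every element of `A − B` is below every element of `B − A`. -/
def LD (A B : Finset ℕ) : Prop := ∀ a ∈ A, a ∉ B → ∀ b ∈ B, b ∉ A → a < b

/-- No element of `B − A` lies between two elements of `A − B`. -/
def Cv (A B : Finset ℕ) : Prop :=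
  ∀ a ∈ A, a ∉ B → ∀ a' ∈ A, a' ∉ B → ∀ b ∈ B, b ∉ A → ¬(a < b ∧ b < a')

/-- Weak separation, elementwise. -/
def WSep (A B : Finset ℕ) : Prop := (#B ≤ #A ∧ Cv A B) ∨ (#A ≤ #B ∧ Cv B A)

/-- Sets of equal size, with `U − Z` lying strictly inside a gap of `Z − U`. -/
def Sur (U Z : Finset ℕ) : Prop := #U = #Z ∧ Cv U Z ∧ ¬ LD U Z ∧ ¬ LD Z U

lemma WSep.symm {A B : Finset ℕ} (h : WSep A B) : WSep B A := Or.symm h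

lemma wsep_comm {A B : Finset ℕ} : WSep A B ↔ WSep B A := ⟨WSep.symm, WSep.symm⟩

lemma LD.refl (A : Finset ℕ) : LD A A := fun _ h h' => absurd h h'

lemma LD.of_subset {A B : Finset ℕ} (h : A ⊆ B) : LD A B := fun _ ha hb => absurd (h ha) hb

lemma LD.of_superset {A B : Finset ℕ} (h : B ⊆ A) : LD A B :=
  fun _ _ _ _ hb hba => absurd (h hb) hba

lemma LD.cv_left {A B : Finset ℕ} (h : LD A B) : Cv A B := fun _ _ _ a' ha' hb' b hb hba hh =>
  absurd (h a' ha' hb' b hb hba) (by omega)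

lemma LD.cv_right {A B : Finset ℕ} (h : LD A B) : Cv B A := fun a ha hab _ _ _ b hb hba hh =>
  absurd (h b hb hba a ha hab) (by omega)

lemma LD.wsep {A B : Finset ℕ} (h : LD A B) : WSep A B := by
  rcases le_total #A #B with h1 | h1
  · exact Or.inr ⟨h1, h.cv_right⟩
  · exact Or.inl ⟨h1, h.cv_left⟩

lemma LD.wsep' {A B : Finset ℕ} (h : LD A B) : WSep B A := h.wsep.symm

lemma WSep.refl (A : Finset ℕ) : WSep A A := (LD.refl A).wsep

lemma exists_mem_notMem_of_card_le {A B : Finset ℕ} (h : #A ≤ #B) {x : ℕ} (hx : x ∈ A)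
    (hxB : x ∉ B) : ∃ y ∈ B, y ∉ A := by
  by_contra! hc
  exact hxB (eq_of_subset_of_card_le hc h ▸ hx)

lemma LD.antisymm {A B : Finset ℕ} (h : LD A B) (h' : LD B A) (hc : #A = #B) : A = B := by
  refine eq_of_subset_of_card_le (fun x hx => ?_) hc.ge
  by_contra hxB
  obtain ⟨y, hy, hyA⟩ := exists_mem_notMem_of_card_le hc.le hx hxB
  exact absurd (h x hx hxB y hy hyA) (not_lt.2 (h' y hy hyA x hx hxB).le)

lemma WSep.cases_of_card_eq {A B : Finset ℕ} (h : WSep A B) (hc : #A = #B) :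
    LD A B ∨ LD B A ∨ Sur A B ∨ Sur B A := by
  unfold WSep at h
  unfold Sur
  grind

lemma WSep.cv_of_card_lt {A B : Finset ℕ} (h : WSep A B) (hc : #A < #B) : Cv B A := by
  rcases h with h | h
  · omega
  · exact h.2

lemma LD.trans_of_le {A B C : Finset ℕ} (h1 : LD A B) (h2 : LD B C) (hs : WSep A C)
    (hAB : #A ≤ #B) (hBC : #B ≤ #C) : LD A C := by
  intro a ha haC c hc hcA
  by_contra hlt
  have hac : c < a := by
    rcases Nat.lt_trichotomy a c with h | h | h
    · exact absurd h hlt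
    · subst h; exact absurd hc haC
    · exact h
  by_cases haB : a ∈ B <;> by_cases hcB : c ∈ B
  · obtain ⟨c', hc', hc'B⟩ := exists_mem_notMem_of_card_le hBC haB haC
    obtain ⟨a0, ha0, ha0B⟩ : ∃ a0 ∈ A, a0 ∉ B ∨ #A < #B := by
      by_cases h : #A < #B
      · exact ⟨a, ha, Or.inr h⟩
      · obtain ⟨y, hy, hyA⟩ := exists_mem_notMem_of_card_le (not_lt.1 h) hcB hcA
        exact ⟨y, hy, Or.inl hyA⟩
    have e1 := h2 a haB haC c' hc' hc'B
    have e2 : c' ∉ A := fun h => by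
      have := h1 c' h hc'B c hcB hcA
      omega
    rcases hs with ⟨hs, hv⟩ | ⟨hs, hv⟩
    · rcases ha0B with h | h
      · have := h1 a0 ha0 h c hcB hcA
        by_cases hh : a0 ∈ C
        · have := h2 a haB haC a0 hh h
          omega
        · exact hv a0 ha0 hh a ha haC c hc hcA ⟨this, hac⟩
      · omega
    · exact hv c hc hcA c' hc' e2 a ha haC ⟨hac, e1⟩
  · exact hlt (by have := h2 a haB haC c hc hcB; omega)
  · exact hlt (by have := h1 a ha haB c hcB hcA; omega)
  · obtain ⟨b, hb, hbA⟩ := exists_mem_notMem_of_card_le hAB ha haB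
    have e1 := h1 a ha haB b hb hbA
    have e2 : b ∈ C := by
      by_contra h
      have := h2 b hb h c hc hcB
      omega
    rcases hs with ⟨hs, hv⟩ | ⟨hs, hv⟩
    · obtain ⟨b', hb', hbC'⟩ := exists_mem_notMem_of_card_le (A := C) (B := B) (by omega) hc hcB
      have e3 := h2 b' hb' hbC' c hc hcB
      by_cases hbA' : b' ∈ A
      · exact hv b' hbA' hbC' a ha haC c hc hcA ⟨e3, hac⟩
      · have := h1 a ha haB b' hb' hbA'
        omega
    · exact hv c hc hcA b e2 hbA a ha haC ⟨hac, e1⟩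

lemma LD.trans_of_ge {A B C : Finset ℕ} (h1 : LD A B) (h2 : LD B C) (hs : WSep A C)
    (hAB : #B ≤ #A) (hBC : #C ≤ #B) : LD A C := by
  intro a ha haC c hc hcA
  by_contra hlt
  have hac : c < a := by
    rcases Nat.lt_trichotomy a c with h | h | h
    · exact absurd h hlt
    · subst h; exact absurd hc haC
    · exact h
  by_cases haB : a ∈ B <;> by_cases hcB : c ∈ B
  · obtain ⟨a', ha', haB'⟩ := exists_mem_notMem_of_card_le hAB hcB hcA
    have e1 := h1 a' ha' haB' c hcB hcA
    have e2 : a' ∉ C := fun h => by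
      have := h2 a haB haC a' h haB'
      omega
    rcases hs with ⟨hs, hv⟩ | ⟨hs, hv⟩
    · exact hv a' ha' e2 a ha haC c hc hcA ⟨e1, hac⟩
    · obtain ⟨c0, hc0, hc0B⟩ := exists_mem_notMem_of_card_le (A := B) (B := C) (by omega) haB haC
      have e3 := h2 a haB haC c0 hc0 hc0B
      by_cases hh : c0 ∈ A
      · have := h1 c0 hh hc0B c hcB hcA
        omega
      · exact hv c hc hcA c0 hc0 hh a ha haC ⟨hac, e3⟩
  · exact hlt (by have := h2 a haB haC c hc hcB; omega)
  · exact hlt (by have := h1 a ha haB c hcB hcA; omega)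
  · obtain ⟨b, hb, hbC⟩ := exists_mem_notMem_of_card_le hBC hc hcB
    have e1 := h2 b hb hbC c hc hcB
    have e2 : b ∈ A := by
      by_contra h
      have := h1 a ha haB b hb h
      omega
    rcases hs with ⟨hs, hv⟩ | ⟨hs, hv⟩
    · exact hv b e2 hbC a ha haC c hc hcA ⟨e1, hac⟩
    · obtain ⟨b', hb', hbA'⟩ := exists_mem_notMem_of_card_le (A := A) (B := B) (by omega) ha haB
      have e3 := h1 a ha haB b' hb' hbA'
      by_cases hbC' : b' ∈ C
      · exact hv c hc hcA b' hbC' hbA' a ha haC ⟨hac, e3⟩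
      · have := h2 b' hb' hbC' c hc hcB
        omega

lemma LD.icc_left {m k : ℕ} {X : Finset ℕ} (hX : X ⊆ Icc 1 m) : LD (Icc 1 k) X := by
  intro a ha haX b hb hbk
  have := mem_Icc.1 (hX hb)
  simp at ha hbk
  omega

lemma LD.icc_right {m k : ℕ} {X : Finset ℕ} (hX : X ⊆ Icc 1 m) : LD X (Icc (k + 1) m) := by
  intro a ha haX b hb hbk
  have := mem_Icc.1 (hX ha)
  simp at hb haX
  omega

lemma succ_notMem {m : ℕ} {X : Finset ℕ} (hX : X ⊆ Icc 1 m) : m + 1 ∉ X := fun h => by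
  have := mem_Icc.1 (hX h)
  omega

lemma lt_succ_of_mem {m : ℕ} {X : Finset ℕ} (hX : X ⊆ Icc 1 m) {x : ℕ} (hx : x ∈ X) :
    x < m + 1 := by
  have := mem_Icc.1 (hX hx)
  omega

lemma card_insert_succ {m : ℕ} {X : Finset ℕ} (hX : X ⊆ Icc 1 m) :
    #(insert (m + 1) X) = #X + 1 := card_insert_of_notMem (succ_notMem hX)

lemma ld_insert_right {m : ℕ} {X Y : Finset ℕ} (hX : X ⊆ Icc 1 m) :
    LD X (insert (m + 1) Y) ↔ LD X Y := by
  have h1 := succ_notMem hX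
  have h2 := @lt_succ_of_mem m X hX
  unfold LD
  constructor
  · intro h a ha haY b hb hbX
    exact h a ha (by grind) b (by grind) hbX
  · intro h a ha haY b hb hbX
    grind

lemma ld_insert_insert {m : ℕ} {X Y : Finset ℕ} (hX : X ⊆ Icc 1 m) (hY : Y ⊆ Icc 1 m) :
    LD (insert (m + 1) X) (insert (m + 1) Y) ↔ LD X Y := by
  have h1 := succ_notMem hX
  have h2 := succ_notMem hY
  unfold LD
  constructor
  · intro h a ha haY b hb hbX
    exact h a (by grind) (by grind) b (by grind) (by grind)
  · intro h a ha haY b hb hbX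
    exact h a (by grind) (by grind) b (by grind) (by grind)

lemma subset_of_ld_insert_left {m : ℕ} {X Y : Finset ℕ} (hX : X ⊆ Icc 1 m)
    (h : LD (insert (m + 1) Y) X) : X ⊆ Y := by
  intro x hx
  by_contra hxY
  have h3 := lt_succ_of_mem hX hx
  have := h (m + 1) (mem_insert_self _ _) (succ_notMem hX) x hx (by grind)
  omega

lemma cv_insert_insert {m : ℕ} {X Y : Finset ℕ} (hX : X ⊆ Icc 1 m) (hY : Y ⊆ Icc 1 m) :
    Cv (insert (m + 1) X) (insert (m + 1) Y) ↔ Cv X Y := by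
  have h1 := succ_notMem hX
  have h2 := succ_notMem hY
  unfold Cv
  constructor
  · intro h a ha haY a' ha' haY' b hb hbX
    exact h a (by grind) (by grind) a' (by grind) (by grind) b (by grind) (by grind)
  · intro h a ha haY a' ha' haY' b hb hbX
    exact h a (by grind) (by grind) a' (by grind) (by grind) b (by grind) (by grind)

lemma cv_insert_right {m : ℕ} {X Y : Finset ℕ} (hX : X ⊆ Icc 1 m) :
    Cv X (insert (m + 1) Y) ↔ Cv X Y := by
  have h1 := succ_notMem hX
  have h2 := @lt_succ_of_mem m X hX
  unfold Cv
  constructor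
  · intro h a ha haY a' ha' haY' b hb hbX
    exact h a (by grind) (by grind) a' (by grind) (by grind) b (by grind) (by grind)
  · intro h a ha haY a' ha' haY' b hb hbX
    grind

lemma cv_insert_left {m : ℕ} {X Y : Finset ℕ} (hX : X ⊆ Icc 1 m) :
    Cv (insert (m + 1) Y) X ↔ LD X Y := by
  have h1 := succ_notMem hX
  have h2 := @lt_succ_of_mem m X hX
  unfold Cv LD
  constructor
  · intro h a ha haY b hb hbX
    have := h b (by grind) hbX (m + 1) (mem_insert_self _ _) h1 a ha (by grind)
    grind
  · intro h a ha haY a' ha' haY' b hb hbX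
    grind

lemma wsep_insert_insert {m : ℕ} {X Y : Finset ℕ} (hX : X ⊆ Icc 1 m) (hY : Y ⊆ Icc 1 m) :
    WSep (insert (m + 1) X) (insert (m + 1) Y) ↔ WSep X Y := by
  unfold WSep
  rw [cv_insert_insert hX hY, cv_insert_insert hY hX, card_insert_succ hX, card_insert_succ hY]
  simp

lemma wsep_insert_right {m : ℕ} {X Y : Finset ℕ} (hX : X ⊆ Icc 1 m) (hY : Y ⊆ Icc 1 m) :
    WSep X (insert (m + 1) Y) ↔ WSep X Y ∧ (#X ≤ #Y → LD X Y) := by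
  unfold WSep
  rw [cv_insert_right hX, cv_insert_left hX, card_insert_succ hY]
  constructor
  · rintro (⟨h1, h2⟩ | ⟨h1, h2⟩)
    · exact ⟨Or.inl ⟨by omega, h2⟩, fun h => by omega⟩
    · exact ⟨h2.wsep, fun _ => h2⟩
  · rintro ⟨h1, h2⟩
    by_cases h : #X ≤ #Y
    · exact Or.inr ⟨by omega, h2 h⟩
    · rcases h1 with h1 | h1
      · exact Or.inl ⟨by omega, h1.2⟩
      · omega

lemma sur_insert_insert {m : ℕ} {X Y : Finset ℕ} (hX : X ⊆ Icc 1 m) (hY : Y ⊆ Icc 1 m) :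
    Sur (insert (m + 1) X) (insert (m + 1) Y) ↔ Sur X Y := by
  unfold Sur
  rw [cv_insert_insert hX hY, ld_insert_insert hX hY, ld_insert_insert hY hX,
    card_insert_succ hX, card_insert_succ hY]
  simp

/-- The two elements of `Z − U` enclosing `U − Z`. -/
lemma Sur.exists_bounds {U Z : Finset ℕ} (h : Sur U Z) :
    ∃ z ∈ Z, z ∉ U ∧ ∃ z' ∈ Z, z' ∉ U ∧ ∀ u ∈ U, u ∉ Z → z < u ∧ u < z' := by
  obtain ⟨h1, h2, h3, h4⟩ := h
  unfold LD at h3 h4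
  push Not at h3 h4
  obtain ⟨a, ha, haZ, b, hb, hbU, hab⟩ := h3
  obtain ⟨a', ha', haZ', b', hb', hbU', hab'⟩ := h4
  refine ⟨b, hb, hbU, a', ha', haZ', fun u hu huZ => ⟨?_, ?_⟩⟩
  · by_contra hc
    have := h2 u hu huZ a ha haZ b hb hbU
    grind
  · by_contra hc
    have := h2 b' hb' hbU' u hu huZ a' ha' haZ'
    grind

lemma Sur.not_wsep_erase {U Z : Finset ℕ} (h : Sur U Z) {s : ℕ} (hs : s ∈ U) :
    ¬ WSep (U.erase s) Z := by
  obtain ⟨z, hz, hzU, z', hz', hzU', hb⟩ := h.exists_bounds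
  have hc := h.1
  have hc1 := card_erase_add_one hs
  intro hsep
  have hv := hsep.cv_of_card_lt (by omega)
  have key : ∃ u ∈ U, u ∉ Z ∧ u ≠ s := by
    by_contra! hcon
    have : U.erase s ⊆ (Z.erase z).erase z' := by
      intro x hx
      grind
    have h3 := card_le_card this
    have h4 := card_erase_add_one hz
    have hne : z ≠ z' := by
      obtain ⟨u, hu, huZ⟩ := exists_mem_notMem_of_card_le hc.ge hz hzU
      have := hb u hu huZ
      omega
    have h5 := card_erase_add_one (s := Z.erase z) (a := z') (by grind)
    omega
  obtain ⟨u, hu, huZ, hus⟩ := key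
  exact hv z hz (by grind) z' hz' (by grind) u (by grind) huZ (hb u hu huZ)

lemma Sur.not_wsep_of_subset {U Z c : Finset ℕ} (h : Sur U Z) (hc : c ⊆ U) (hcard : #c + 1 = #U) :
    ¬ WSep c Z := by
  obtain ⟨s, hs, hsc⟩ : ∃ s ∈ U, s ∉ c := by
    by_contra! hcon
    have := card_le_card (show U ⊆ c from hcon)
    omega
  have : c = U.erase s := by
    refine eq_of_subset_of_card_le (fun x hx => ?_) ?_
    · grind
    · have := card_erase_add_one hs
      omega
  exact this ▸ h.not_wsep_erase hs

lemma LD.ld_or_subset_of_insert {c S : Finset ℕ} {a a2 : ℕ} (haS : a ∉ S) (h2S : a2 ∉ S)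
    (ha : a < a2) (hcard : #c = #S) (h : LD c (insert a S)) (hs : WSep c (insert a2 S)) :
    LD c S ∨ c ⊆ insert a S := by
  by_contra! hcon
  obtain ⟨hcon1, hcon2⟩ := hcon
  unfold LD at hcon1
  push Not at hcon1
  obtain ⟨x, hx, hxS, y, hy, hyc, hxy⟩ := hcon1
  obtain ⟨p, hp, hpS⟩ := not_subset.1 hcon2
  have hxa : x = a := by
    by_contra hne
    have := h x hx (by grind) y (by grind) hyc
    omega
  subst hxa
  have hpy := h p hp hpS y (by grind) hyc
  have hyx : y ≠ x := by grind
  have hca : a2 ∉ c := fun h' => by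
    have := h a2 h' (by grind) y (by grind) hyc
    omega
  rcases hs with ⟨_, hv⟩ | ⟨_, hv⟩
  · exact hv p hp (by grind) x hx (by grind) y (by grind) hyc ⟨hpy, by omega⟩
  · exact hv y (by grind) hyc a2 (by grind) hca x hx (by grind) ⟨by omega, ha⟩

lemma LD.subset_of_between {S B : Finset ℕ} {a1 a2 : ℕ} (h1S : a1 ∉ S) (h2S : a2 ∉ S)
    (hne : a1 ≠ a2) (h1 : LD (insert a1 S) B) (h2 : LD B (insert a2 S))
    (hcard : #B = #S + 1) (hs : WSep S B) :
    ∃ x, x ∉ S ∧ a1 ≤ x ∧ x ≤ a2 ∧ B = insert x S := by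
  have hsub : S ⊆ B := by
    intro s hsS
    by_contra hsB
    have hy : ∀ y ∈ B, y ∉ S → (y = a1 ∧ y < s) ∨ (y = a2 ∧ s < y) := by
      intro y hy hyS
      have e1 : y ≠ a1 → s < y := fun h => h1 s (by grind) hsB y hy (by grind)
      have e2 : y ≠ a2 → y < s := fun h => h2 y hy (by grind) s (by grind) hsB
      grind
    have hv := hs.cv_of_card_lt (by omega)
    have h3 : 1 < #(B \ S) := by
      have e1 := card_sdiff_add_card_inter B S
      have e2 : #(B ∩ S) < #S := card_lt_card (by
        refine ⟨inter_subset_right, fun h => hsB (mem_inter.1 (h hsS)).1⟩)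
      omega
    obtain ⟨p, hp, q, hq, hpq⟩ := one_lt_card.1 h3
    simp only [mem_sdiff] at hp hq
    have e1 := hy p hp.1 hp.2
    have e2 := hy q hq.1 hq.2
    have e3 := hv p hp.1 hp.2 q hq.1 hq.2 s hsS hsB
    have e4 := hv q hq.1 hq.2 p hp.1 hp.2 s hsS hsB
    omega
  obtain ⟨x, hx, hxS⟩ : ∃ x ∈ B, x ∉ S := by
    by_contra! hcon
    have := card_le_card (show B ⊆ S from hcon)
    omega
  have hB : insert x S = B := eq_of_subset_of_card_le (insert_subset hx hsub) (by
    rw [card_insert_of_notMem hxS]; omega)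
  refine ⟨x, hxS, ?_, ?_, hB.symm⟩
  · by_contra hc
    have := h1 a1 (by grind) (by grind) x hx (by grind)
    omega
  · by_contra hc
    have := h2 x hx (by grind) a2 (by grind) (by grind)
    omega

/-- A maximal weakly separated collection in the Boolean cube on `{1, …, m}`. -/
structure MaxW (m : ℕ) (G : Finset (Finset ℕ)) : Prop where
  sub : ∀ X ∈ G, X ⊆ Icc 1 m
  wsep : ∀ X ∈ G, ∀ Y ∈ G, WSep X Y
  mem : ∀ X ⊆ Icc 1 m, (∀ A ∈ G, WSep X A) → X ∈ G

/-- Every weakly separated collection extends to a maximal one. -/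
lemma exists_maxW {m : ℕ} {G : Finset (Finset ℕ)} (hsub : ∀ X ∈ G, X ⊆ Icc 1 m)
    (hsep : ∀ X ∈ G, ∀ Y ∈ G, WSep X Y) : ∃ M, MaxW m M ∧ G ⊆ M := by
  classical
  obtain ⟨M, hGM, hM⟩ := Finset.exists_le_maximal
    ((Icc 1 m).powerset.powerset.filter fun H => ∀ X ∈ H, ∀ Y ∈ H, WSep X Y) (a := G)
    (by
      simp only [mem_filter, mem_powerset]
      exact ⟨fun X hX => mem_powerset.2 (hsub X hX), hsep⟩)
  have hM1 := hM.prop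
  simp only [mem_filter, mem_powerset] at hM1
  refine ⟨M, ⟨fun X hX => mem_powerset.1 (hM1.1 hX), hM1.2, fun X hX hA => ?_⟩, hGM⟩
  have : insert X M ≤ M := hM.le_of_ge (by
    simp only [mem_filter, mem_powerset]
    refine ⟨insert_subset (mem_powerset.2 hX) hM1.1, ?_⟩
    intro Y hY Z hZ
    rcases mem_insert.1 hY with e | hY' <;> rcases mem_insert.1 hZ with e' | hZ'
    · exact e ▸ e' ▸ WSep.refl _
    · exact e ▸ hA _ hZ'
    · exact e' ▸ (hA _ hY').symm
    · exact hM1.2 _ hY' _ hZ') (subset_insert _ _)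
  exact this (mem_insert_self _ _)

/-- Complement in `{1, …, m}`. -/
def cpl (m : ℕ) (X : Finset ℕ) : Finset ℕ := Icc 1 m \ X

/-- Complement of the mirror image in `{1, …, m}`. -/
def rcpl (m : ℕ) (X : Finset ℕ) : Finset ℕ := {i ∈ Icc 1 m | m + 1 - i ∉ X}

lemma cpl_subset (m : ℕ) (X : Finset ℕ) : cpl m X ⊆ Icc 1 m := sdiff_subset

lemma rcpl_subset (m : ℕ) (X : Finset ℕ) : rcpl m X ⊆ Icc 1 m := filter_subset _ _

lemma mem_cpl {m : ℕ} {X : Finset ℕ} {i : ℕ} : i ∈ cpl m X ↔ (1 ≤ i ∧ i ≤ m) ∧ i ∉ X := by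
  simp [cpl]

lemma mem_rcpl {m : ℕ} {X : Finset ℕ} {i : ℕ} :
    i ∈ rcpl m X ↔ (1 ≤ i ∧ i ≤ m) ∧ m + 1 - i ∉ X := by
  simp [rcpl]

lemma cpl_cpl {m : ℕ} {X : Finset ℕ} (hX : X ⊆ Icc 1 m) : cpl m (cpl m X) = X := by
  unfold cpl
  exact Finset.sdiff_sdiff_eq_self hX

lemma mem_bounds {m : ℕ} {X : Finset ℕ} (hX : X ⊆ Icc 1 m) {i : ℕ} (hi : i ∈ X) :
    1 ≤ i ∧ i ≤ m := mem_Icc.1 (hX hi)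

lemma rcpl_rcpl {m : ℕ} {X : Finset ℕ} (hX : X ⊆ Icc 1 m) : rcpl m (rcpl m X) = X := by
  ext i
  rw [mem_rcpl, mem_rcpl]
  constructor
  · rintro ⟨h1, h2⟩
    by_contra h
    refine h2 ⟨by omega, ?_⟩
    rwa [show m + 1 - (m + 1 - i) = i by omega]
  · intro h
    have := mem_bounds hX h
    refine ⟨this, fun h' => h'.2 ?_⟩
    rwa [show m + 1 - (m + 1 - i) = i by omega]

lemma card_cpl {m : ℕ} {X : Finset ℕ} (hX : X ⊆ Icc 1 m) : #(cpl m X) + #X = m := by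
  have := card_sdiff_add_card_eq_card hX
  simpa [cpl] using this

lemma card_rcpl {m : ℕ} {X : Finset ℕ} (hX : X ⊆ Icc 1 m) : #(rcpl m X) + #X = m := by
  rw [show #(rcpl m X) = #(cpl m X) from ?_, card_cpl hX]
  refine card_bij' (fun i _ => m + 1 - i) (fun i _ => m + 1 - i) ?_ ?_ ?_ ?_ <;>
    simp only [mem_rcpl, mem_cpl]
  · rintro a ⟨h1, h2⟩
    exact ⟨by omega, h2⟩
  · rintro a ⟨h1, h2⟩
    rw [show m + 1 - (m + 1 - a) = a by omega]
    exact ⟨by omega, h2⟩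
  · intros; omega
  · intros; omega

lemma cv_rcpl_of_cv {m : ℕ} {X Y : Finset ℕ} (h : Cv X Y) : Cv (rcpl m Y) (rcpl m X) := by
  intro a ha haY a' ha' haY' b hb hbX
  simp only [mem_rcpl] at ha haY ha' haY' hb hbX
  have := h (m + 1 - a') (by tauto) (by tauto) (m + 1 - a) (by tauto) (by tauto) (m + 1 - b)
    (by tauto) (by tauto)
  omega

section
variable {m : ℕ} {X Y : Finset ℕ} (hX : X ⊆ Icc 1 m) (hY : Y ⊆ Icc 1 m)
include hX hY

lemma ld_cpl : LD (cpl m X) (cpl m Y) ↔ LD Y X := by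
  have h1 := @mem_bounds m X hX
  have h2 := @mem_bounds m Y hY
  unfold LD
  simp only [mem_cpl]
  constructor
  · intro h a ha haX b hb hbY
    exact h a ⟨h2 ha, haX⟩ (by tauto) b ⟨h1 hb, hbY⟩ (by tauto)
  · intro h a ha haX b hb hbY
    exact h a (by tauto) (by tauto) b (by tauto) (by tauto)

lemma cv_cpl : Cv (cpl m X) (cpl m Y) ↔ Cv Y X := by
  have h1 := @mem_bounds m X hX
  have h2 := @mem_bounds m Y hY
  unfold Cv
  simp only [mem_cpl]
  constructor
  · intro h a ha haX a' ha' haX' b hb hbY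
    exact h a ⟨h2 ha, haX⟩ (by tauto) a' ⟨h2 ha', haX'⟩ (by tauto) b ⟨h1 hb, hbY⟩ (by tauto)
  · intro h a ha haX a' ha' haX' b hb hbY
    exact h a (by tauto) (by tauto) a' (by tauto) (by tauto) b (by tauto) (by tauto)

lemma ld_rcpl_of_ld (h : LD X Y) : LD (rcpl m X) (rcpl m Y) := by
  have h1 := @mem_bounds m X hX
  have h2 := @mem_bounds m Y hY
  intro a ha haY b hb hbX
  simp only [mem_rcpl] at ha haY hb hbX
  have := h (m + 1 - b) (by tauto) hb.2 (m + 1 - a) (by tauto) (by tauto)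
  omega

lemma ld_rcpl : LD (rcpl m X) (rcpl m Y) ↔ LD X Y := by
  refine ⟨fun h => ?_, ld_rcpl_of_ld hX hY⟩
  have := ld_rcpl_of_ld (rcpl_subset m X) (rcpl_subset m Y) h
  rwa [rcpl_rcpl hX, rcpl_rcpl hY] at this

lemma cv_rcpl : Cv (rcpl m X) (rcpl m Y) ↔ Cv Y X := by
  refine ⟨fun h => ?_, cv_rcpl_of_cv⟩
  have := cv_rcpl_of_cv (m := m) h
  rwa [rcpl_rcpl hX, rcpl_rcpl hY] at this

lemma wsep_cpl : WSep (cpl m X) (cpl m Y) ↔ WSep X Y := by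
  have h1 := card_cpl hX
  have h2 := card_cpl hY
  unfold WSep
  rw [cv_cpl hX hY, cv_cpl hY hX, show #(cpl m Y) ≤ #(cpl m X) ↔ #X ≤ #Y by omega,
    show #(cpl m X) ≤ #(cpl m Y) ↔ #Y ≤ #X by omega]
  exact or_comm

lemma wsep_rcpl : WSep (rcpl m X) (rcpl m Y) ↔ WSep X Y := by
  have h1 := card_rcpl hX
  have h2 := card_rcpl hY
  unfold WSep
  rw [cv_rcpl hX hY, cv_rcpl hY hX, show #(rcpl m Y) ≤ #(rcpl m X) ↔ #X ≤ #Y by omega,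
    show #(rcpl m X) ≤ #(rcpl m Y) ↔ #Y ≤ #X by omega]
  exact or_comm

lemma sur_cpl : Sur (cpl m X) (cpl m Y) ↔ Sur Y X := by
  have h1 := card_cpl hX
  have h2 := card_cpl hY
  unfold Sur
  rw [cv_cpl hX hY, ld_cpl hX hY, ld_cpl hY hX, show #(cpl m X) = #(cpl m Y) ↔ #Y = #X by omega]

lemma sur_rcpl : Sur (rcpl m X) (rcpl m Y) ↔ Sur Y X := by
  have h1 := card_rcpl hX
  have h2 := card_rcpl hY
  unfold Sur
  rw [cv_rcpl hX hY, ld_rcpl hX hY, ld_rcpl hY hX,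
    show #(rcpl m X) = #(rcpl m Y) ↔ #Y = #X by omega]
  tauto

end

namespace MaxW
variable {m : ℕ} {G : Finset (Finset ℕ)}

lemma mem_image_cpl (h : MaxW m G) {X : Finset ℕ} (hX : X ⊆ Icc 1 m) :
    X ∈ G.image (cpl m) ↔ cpl m X ∈ G := by
  rw [mem_image]
  constructor
  · rintro ⟨Y, hY, rfl⟩
    rwa [cpl_cpl (h.sub Y hY)]
  · exact fun hh => ⟨_, hh, cpl_cpl hX⟩

lemma mem_image_rcpl (h : MaxW m G) {X : Finset ℕ} (hX : X ⊆ Icc 1 m) :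
    X ∈ G.image (rcpl m) ↔ rcpl m X ∈ G := by
  rw [mem_image]
  constructor
  · rintro ⟨Y, hY, rfl⟩
    rwa [rcpl_rcpl (h.sub Y hY)]
  · exact fun hh => ⟨_, hh, rcpl_rcpl hX⟩

lemma image_cpl (h : MaxW m G) : MaxW m (G.image (cpl m)) := by
  refine ⟨?_, ?_, fun X hX hA => ?_⟩
  · simp only [mem_image]
    rintro X ⟨Y, hY, rfl⟩
    exact cpl_subset m Y
  · simp only [mem_image]
    rintro X ⟨Y, hY, rfl⟩ X' ⟨Y', hY', rfl⟩
    exact (wsep_cpl (h.sub Y hY) (h.sub Y' hY')).2 (h.wsep Y hY Y' hY')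
  · rw [h.mem_image_cpl hX]
    refine h.mem _ (cpl_subset m X) fun A hA' => ?_
    rw [← cpl_cpl (h.sub A hA'), wsep_cpl hX (cpl_subset m A)]
    exact hA _ (mem_image_of_mem _ hA')

lemma image_rcpl (h : MaxW m G) : MaxW m (G.image (rcpl m)) := by
  refine ⟨?_, ?_, fun X hX hA => ?_⟩
  · simp only [mem_image]
    rintro X ⟨Y, hY, rfl⟩
    exact rcpl_subset m Y
  · simp only [mem_image]
    rintro X ⟨Y, hY, rfl⟩ X' ⟨Y', hY', rfl⟩
    exact (wsep_rcpl (h.sub Y hY) (h.sub Y' hY')).2 (h.wsep Y hY Y' hY')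
  · rw [h.mem_image_rcpl hX]
    refine h.mem _ (rcpl_subset m X) fun A hA' => ?_
    rw [← rcpl_rcpl (h.sub A hA'), wsep_rcpl hX (rcpl_subset m A)]
    exact hA _ (mem_image_of_mem _ hA')

lemma icc_left_mem (h : MaxW m G) {k : ℕ} (hk : k ≤ m) : Icc 1 k ∈ G :=
  h.mem _ (Icc_subset_Icc_right hk) fun A hA => (LD.icc_left (h.sub A hA)).wsep

lemma icc_right_mem (h : MaxW m G) (k : ℕ) : Icc (k + 1) m ∈ G :=
  h.mem _ (Icc_subset_Icc_left (by omega)) fun A hA => (LD.icc_right (h.sub A hA)).wsep'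

lemma card_le (h : MaxW m G) {X : Finset ℕ} (hX : X ∈ G) : #X ≤ m := by
  simpa using card_le_card (h.sub X hX)

lemma trans_le (h : MaxW m G) {A B C : Finset ℕ} (hA : A ∈ G) (hC : C ∈ G) (h1 : LD A B)
    (h2 : LD B C) (hAB : #A ≤ #B) (hBC : #B ≤ #C) : LD A C :=
  h1.trans_of_le h2 (h.wsep A hA C hC) hAB hBC

lemma trans_ge (h : MaxW m G) {A B C : Finset ℕ} (hA : A ∈ G) (hC : C ∈ G) (h1 : LD A B)
    (h2 : LD B C) (hAB : #B ≤ #A) (hBC : #C ≤ #B) : LD A C :=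
  h1.trans_of_ge h2 (h.wsep A hA C hC) hAB hBC

end MaxW

/-- `A ⋖ B` (weakly) with `|A| ≤ |B|`. -/
def Le1 (A B : Finset ℕ) : Prop := #A ≤ #B ∧ LD A B

/-- `A ⋖ B` (weakly) with `|B| ≤ |A|`. -/
def Le2 (A B : Finset ℕ) : Prop := #B ≤ #A ∧ LD A B

/-- `X₁` and `X₂` have a join in `F` for the order `Le1`. -/
def HasJoin (F : Finset (Finset ℕ)) (X₁ X₂ : Finset ℕ) : Prop :=
  ∃ J ∈ F, Le1 X₁ J ∧ Le1 X₂ J ∧ ∀ Y ∈ F, Le1 X₁ Y → Le1 X₂ Y → Le1 J Y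

lemma HasJoin.symm {F : Finset (Finset ℕ)} {X₁ X₂ : Finset ℕ} (h : HasJoin F X₁ X₂) :
    HasJoin F X₂ X₁ := by
  obtain ⟨J, hJ, h1, h2, h3⟩ := h
  exact ⟨J, hJ, h2, h1, fun Y hY e1 e2 => h3 Y hY e2 e1⟩

/-- `U` covers a member `U − {a}` of `F` that is least among the members above `U` one size down,
and `a` can be replaced by something smaller unless `U` is an initial segment. -/
def HasDescend (F : Finset (Finset ℕ)) (U : Finset ℕ) : Prop :=
  ∃ a ∈ U, U.erase a ∈ F ∧ (∀ z ∈ F, #z + 1 = #U → LD U z → LD (U.erase a) z) ∧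
    ((U.erase a = Icc 1 (#U - 1) ∧ U = Icc 1 #U) ∨
      ∃ a₁ < a, a₁ ∉ U ∧ insert a₁ (U.erase a) ∈ F)

/-- An element `a` of `U` can be replaced in `F` both by something smaller and by something larger,
and only the members around `U` obstruct `U − {a}`. -/
def HasExchange (F : Finset (Finset ℕ)) (U : Finset ℕ) : Prop :=
  ∃ a ∈ U, ∃ a₁ a₂, a₁ ∉ U ∧ a₂ ∉ U ∧ a₁ < a ∧ a < a₂ ∧
    insert a₁ (U.erase a) ∈ F ∧ insert a₂ (U.erase a) ∈ F ∧
    ∀ V ∈ F, ¬ WSep V (U.erase a) → Sur U V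

/-- The structural properties of a maximal weakly separated collection that are carried through
the induction on `m`. -/
structure Good (m : ℕ) (G : Finset (Finset ℕ)) : Prop where
  join : ∀ X₁ ∈ G, ∀ X₂ ∈ G, HasJoin G X₁ X₂
  descend : ∀ U ∈ G, U.Nonempty → (∀ Z ∈ G, ¬ Sur U Z) → HasDescend G U
  exchange : ∀ U ∈ G, ∀ Z ∈ G, Sur U Z → HasExchange G U
  card_eq : 2 * #G = m * (m + 1) + 2

/-- Finite joins from binary joins. -/
lemma exists_finset_join {α : Type*} [DecidableEq α] {r : α → α → Prop} {G : Finset α}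
    (hrefl : ∀ a, r a a)
    (htrans : ∀ a ∈ G, ∀ b ∈ G, ∀ c ∈ G, r a b → r b c → r a c)
    (hjoin : ∀ a ∈ G, ∀ b ∈ G, ∃ j ∈ G, r a j ∧ r b j ∧ ∀ y ∈ G, r a y → r b y → r j y)
    {T : Finset α} (hT : T.Nonempty) (hTG : T ⊆ G) :
    ∃ j ∈ G, (∀ x ∈ T, r x j) ∧ ∀ y ∈ G, (∀ x ∈ T, r x y) → r j y := by
  induction hT using Finset.Nonempty.cons_induction with
  | singleton a =>
    exact ⟨a, hTG (mem_singleton_self a), by simpa using hrefl a, by simp⟩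
  | cons a s h hs ih =>
    obtain ⟨j, hj, h1, h2⟩ := ih fun x hx => hTG (mem_cons_of_mem hx)
    have ha : a ∈ G := hTG (mem_cons_self a s)
    obtain ⟨j', hj', h3, h4, h5⟩ := hjoin a ha j hj
    refine ⟨j', hj', ?_, ?_⟩
    · simp only [mem_cons, forall_eq_or_imp]
      exact ⟨h3, fun x hx => htrans x (hTG (mem_cons_of_mem hx)) j hj j' hj' (h1 x hx) h4⟩
    · simp only [mem_cons, forall_eq_or_imp]
      exact fun y hy hh => h5 y hy hh.1 (h2 y hy hh.2)

lemma exists_eq_insert_of_subset {A B : Finset ℕ} (h : A ⊆ B) (hc : #B = #A + 1) :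
    ∃ x, x ∉ A ∧ B = insert x A := by
  obtain ⟨x, hx, e⟩ := (covBy_iff_exists_insert (s := A) (t := B)).1
    (covBy_iff_card_sdiff_eq_one.2 ⟨h, by rw [card_sdiff_of_subset h]; omega⟩)
  exact ⟨x, hx, e.symm⟩

lemma eq_erase_of_subset {A B : Finset ℕ} (h : A ⊆ B) (hc : #B = #A + 1) :
    ∃ x ∈ B, A = B.erase x := by
  obtain ⟨x, hx, rfl⟩ := exists_eq_insert_of_subset h hc
  exact ⟨x, mem_insert_self _ _, (erase_insert hx).symm⟩

lemma card_icc_one (k : ℕ) : #(Icc 1 k) = k := by simp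

lemma card_icc_right {m k : ℕ} (hk : k ≤ m) : #(Icc (m - k + 1) m) = k := by
  simp
  omega

namespace MaxW
variable {m : ℕ} {G : Finset (Finset ℕ)}

lemma le1_trans (h : MaxW m G) {A B C : Finset ℕ} (hA : A ∈ G) (hC : C ∈ G) (h1 : Le1 A B)
    (h2 : Le1 B C) : Le1 A C :=
  ⟨h1.1.trans h2.1, h.trans_le hA hC h1.2 h2.2 h1.1 h2.1⟩

lemma le2_trans (h : MaxW m G) {A B C : Finset ℕ} (hA : A ∈ G) (hC : C ∈ G) (h1 : Le2 A B)
    (h2 : Le2 B C) : Le2 A C :=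
  ⟨h2.1.trans h1.1, h.trans_ge hA hC h1.2 h2.2 h1.1 h2.1⟩

lemma le2_iff_rcpl {A B : Finset ℕ} (hA : A ⊆ Icc 1 m) (hB : B ⊆ Icc 1 m) :
    Le1 (rcpl m A) (rcpl m B) ↔ Le2 A B := by
  have h1 := card_rcpl hA
  have h2 := card_rcpl hB
  unfold Le1 Le2
  rw [ld_rcpl hA hB]
  constructor <;> rintro ⟨h3, h4⟩ <;> exact ⟨by omega, h4⟩

lemma rcpl_mem (_h : MaxW m G) {A : Finset ℕ} (hA : A ∈ G) : rcpl m A ∈ G.image (rcpl m) :=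
  mem_image_of_mem _ hA

/-- The least element above `X` among the members of size `k`. -/
lemma exists_least_ge (hJ : ∀ G, MaxW m G → ∀ X₁ ∈ G, ∀ X₂ ∈ G, HasJoin G X₁ X₂)
    (h : MaxW m G) {X : Finset ℕ} (hX : X ∈ G) {k : ℕ} (hk : #X ≤ k)
    (hkm : k ≤ m) : ∃ z ∈ G, #z = k ∧ LD X z ∧ ∀ Y ∈ G, k ≤ #Y → LD X Y → LD z Y := by
  obtain ⟨J, hJG, hJ1, hJ2, hJ3⟩ := hJ _ h _ hX _ (h.icc_left_mem hkm)
  have hc := card_icc_right hkm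
  refine ⟨J, hJG, ?_, hJ1.2, fun Y hY hkY hXY => ?_⟩
  · have := (hJ3 _ (h.icc_right_mem (m - k)) ⟨by omega, LD.icc_right (h.sub _ hX)⟩
      ⟨by rw [hc, card_icc_one], LD.icc_right (Icc_subset_Icc_right hkm)⟩).1
    have e := hJ2.1
    rw [card_icc_one] at e
    omega
  · exact (hJ3 Y hY ⟨by omega, hXY⟩ ⟨by rwa [card_icc_one], LD.icc_left (h.sub Y hY)⟩).2

/-- The least element above `X` among the members of size `t`, from larger to smaller sizes. -/
lemma exists_least_ge_of_le (hJ : ∀ G, MaxW m G → ∀ X₁ ∈ G, ∀ X₂ ∈ G, HasJoin G X₁ X₂)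
    (h : MaxW m G) {X : Finset ℕ} (hX : X ∈ G) {t : ℕ} (ht : t ≤ #X) :
    ∃ w ∈ G, #w = t ∧ LD X w ∧ ∀ Y ∈ G, #Y ≤ t → LD X Y → LD w Y := by
  have hXm := h.sub X hX
  have hc := card_rcpl hXm
  obtain ⟨z, hz, hzc, h1, h2⟩ := h.image_rcpl.exists_least_ge hJ (h.rcpl_mem hX) (k := m - t)
    (by omega) (by omega)
  have hzm := h.image_rcpl.sub z hz
  have hc2 := card_rcpl hzm
  refine ⟨rcpl m z, (h.mem_image_rcpl hzm).1 hz, by omega, ?_, fun Y hY hYc hXY => ?_⟩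
  · rwa [← ld_rcpl hXm (rcpl_subset _ _), rcpl_rcpl hzm]
  · have hYm := h.sub Y hY
    have hc3 := card_rcpl hYm
    rw [← ld_rcpl (rcpl_subset _ _) hYm, rcpl_rcpl hzm]
    exact h2 _ (h.rcpl_mem hY) (by omega) ((ld_rcpl hXm hYm).2 hXY)

variable (hP : ∀ G, MaxW m G → Good m G)
include hP

lemma exists_join2 (h : MaxW m G) {X₁ X₂ : Finset ℕ} (h₁ : X₁ ∈ G) (h₂ : X₂ ∈ G) :
    ∃ J ∈ G, Le2 X₁ J ∧ Le2 X₂ J ∧ ∀ Y ∈ G, Le2 X₁ Y → Le2 X₂ Y → Le2 J Y := by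
  obtain ⟨J, hJ, hJ1, hJ2, hJ3⟩ :=
    (hP _ h.image_rcpl).join _ (h.rcpl_mem h₁) _ (h.rcpl_mem h₂)
  have hJm := h.image_rcpl.sub J hJ
  have e : rcpl m J ⊆ Icc 1 m := rcpl_subset _ _
  refine ⟨rcpl m J, (h.mem_image_rcpl hJm).1 hJ, ?_, ?_, fun Y hY hY1 hY2 => ?_⟩
  · rwa [← le2_iff_rcpl (h.sub _ h₁) e, rcpl_rcpl hJm]
  · rwa [← le2_iff_rcpl (h.sub _ h₂) e, rcpl_rcpl hJm]
  · rw [← le2_iff_rcpl e (h.sub Y hY), rcpl_rcpl hJm]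
    exact hJ3 _ (h.rcpl_mem hY) ((le2_iff_rcpl (h.sub _ h₁) (h.sub Y hY)).2 hY1)
      ((le2_iff_rcpl (h.sub _ h₂) (h.sub Y hY)).2 hY2)

/-- The greatest element below `Y` among the members of size `s ≥ |Y|`. -/
lemma exists_greatest_le (h : MaxW m G) {Y : Finset ℕ} (hY : Y ∈ G) {s : ℕ} (hs : #Y ≤ s)
    (hsm : s ≤ m) : ∃ z ∈ G, #z = s ∧ LD z Y ∧ ∀ z' ∈ G, #z' = s → LD z' Y → LD z' z := by
  classical
  have hT : ({z ∈ G | #z = s ∧ LD z Y} : Finset _).Nonempty :=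
    ⟨Icc 1 s, by simpa using ⟨h.icc_left_mem hsm, LD.icc_left (h.sub Y hY)⟩⟩
  obtain ⟨z, hz, h1, h2⟩ := exists_finset_join (r := Le2) (G := G) (fun a => ⟨le_rfl, LD.refl a⟩)
    (fun a ha b _ c hc => h.le2_trans ha hc) (fun a ha b hb => h.exists_join2 hP ha hb)
    hT (filter_subset _ _)
  simp only [mem_filter] at h1 h2
  have e1 := (h2 _ (h.icc_right_mem (m - s)) fun x hx =>
    ⟨by rw [card_icc_right hsm, hx.2.1], LD.icc_right (h.sub _ hx.1)⟩).1
  have e2 := (h1 (Icc 1 s) ⟨h.icc_left_mem hsm, card_icc_one s, LD.icc_left (h.sub Y hY)⟩).1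
  rw [card_icc_right hsm] at e1
  rw [card_icc_one] at e2
  refine ⟨z, hz, le_antisymm e2 e1, ?_, fun z' hz' hc hL => (h1 z' ⟨hz', hc, hL⟩).2⟩
  exact (h2 Y hY fun x hx => ⟨by omega, hx.2.2⟩).2

lemma exists_ascend (h : MaxW m G) {U : Finset ℕ} (hU : U ∈ G) (hUm : #U < m)
    (hS : ∀ Z ∈ G, ¬ Sur Z U) :
    ∃ x, x ∉ U ∧ insert x U ∈ G ∧ ∀ z ∈ G, #z = #U + 1 → LD U z → LD (insert x U) z := by
  have hUs := h.sub U hU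
  have hc := card_rcpl hUs
  obtain ⟨a, ha, haG, h1, -⟩ := (hP _ h.image_rcpl).descend _ (h.rcpl_mem hU)
    (card_pos.1 (by omega)) (fun Z hZ hSur => by
      have hZm := h.image_rcpl.sub Z hZ
      refine hS (rcpl m Z) ((h.mem_image_rcpl hZm).1 hZ) ?_
      rwa [← sur_rcpl hUs (rcpl_subset _ _), rcpl_rcpl hZm])
  have hSm := h.image_rcpl.sub _ haG
  have hc1 := card_erase_add_one ha
  have hc2 := card_rcpl hSm
  obtain ⟨x, hx, e⟩ := exists_eq_insert_of_subset (A := U) (B := rcpl m ((rcpl m U).erase a))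
    (by
      intro i hi
      have := mem_bounds hUs hi
      refine mem_rcpl.2 ⟨this, fun h' => ?_⟩
      have h'' := (mem_rcpl.1 (mem_erase.1 h').2).2
      rw [show m + 1 - (m + 1 - i) = i by omega] at h''
      exact h'' hi) (by omega)
  refine ⟨x, hx, e ▸ (h.mem_image_rcpl hSm).1 haG, fun z hz hzc hL => ?_⟩
  have hzm := h.sub z hz
  have hc3 := card_rcpl hzm
  rw [← e, ← ld_rcpl (rcpl_subset _ _) hzm, rcpl_rcpl hSm]
  exact h1 _ (h.rcpl_mem hz) (by omega) ((ld_rcpl hUs hzm).2 hL)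

lemma exists_erase_mem (h : MaxW m G) {b : Finset ℕ} (hb : b ∈ G) (hne : b.Nonempty)
    (hcmp : ∀ z ∈ G, #z = #b → LD b z ∨ LD z b) : ∃ a ∈ b, b.erase a ∈ G := by
  obtain ⟨a, ha, haG, -⟩ := (hP _ h).descend b hb hne fun Z hZ hS => by
    rcases hcmp Z hZ hS.1.symm with h' | h'
    · exact hS.2.2.1 h'
    · exact hS.2.2.2 h'
  exact ⟨a, ha, haG⟩

lemma exists_insert_mem (h : MaxW m G) {b : Finset ℕ} (hb : b ∈ G) (hlt : #b < m)
    (hcmp : ∀ z ∈ G, #z = #b → LD b z ∨ LD z b) :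
    ∃ x, x ∉ b ∧ insert x b ∈ G ∧ ∀ z ∈ G, #z = #b + 1 → LD b z → LD (insert x b) z :=
  h.exists_ascend hP hb hlt fun Z hZ hS => by
    rcases hcmp Z hZ hS.1 with h' | h'
    · exact hS.2.2.2 h'
    · exact hS.2.2.1 h'

end MaxW

lemma subset_or_eq_insert {m : ℕ} {A : Finset ℕ} (hA : A ⊆ Icc 1 (m + 1)) :
    A ⊆ Icc 1 m ∨ ∃ Y ⊆ Icc 1 m, A = insert (m + 1) Y := by
  by_cases h : m + 1 ∈ A
  · refine Or.inr ⟨A.erase (m + 1), fun x hx => ?_, (insert_erase h).symm⟩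
    have h1 := mem_erase.1 hx
    have := mem_Icc.1 (hA h1.2)
    exact mem_Icc.2 (by omega)
  · refine Or.inl fun x hx => ?_
    have := mem_Icc.1 (hA hx)
    have : x ≠ m + 1 := fun e => h (e ▸ hx)
    exact mem_Icc.2 (by omega)

lemma insert_succ_subset {m : ℕ} {Y : Finset ℕ} (hY : Y ⊆ Icc 1 m) :
    insert (m + 1) Y ⊆ Icc 1 (m + 1) :=
  insert_subset (by simp) (hY.trans (Icc_subset_Icc_right (by omega)))

lemma subset_icc_succ {m : ℕ} {Y : Finset ℕ} (hY : Y ⊆ Icc 1 m) : Y ⊆ Icc 1 (m + 1) :=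
  hY.trans (Icc_subset_Icc_right (by omega))

lemma insert_succ_inj {m : ℕ} {X Y : Finset ℕ} (hX : X ⊆ Icc 1 m) (hY : Y ⊆ Icc 1 m)
    (h : insert (m + 1) X = insert (m + 1) Y) : X = Y := by
  have := congrArg (fun s => s.erase (m + 1)) h
  simpa [erase_insert (succ_notMem hX), erase_insert (succ_notMem hY)] using this

namespace MaxW
variable {m : ℕ} {F : Finset (Finset ℕ)}

lemma mem_of_left (h : MaxW (m + 1) F) {X : Finset ℕ} (hX : X ⊆ Icc 1 m)
    (h1 : ∀ A ⊆ Icc 1 m, A ∈ F → WSep X A)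
    (h2 : ∀ Y ⊆ Icc 1 m, insert (m + 1) Y ∈ F → WSep X Y ∧ (#X ≤ #Y → LD X Y)) : X ∈ F := by
  refine h.mem X (subset_icc_succ hX) fun A hA => ?_
  rcases subset_or_eq_insert (h.sub A hA) with hAm | ⟨Y, hY, rfl⟩
  · exact h1 A hAm hA
  · exact (wsep_insert_right hX hY).2 (h2 Y hY hA)

lemma mem_of_right (h : MaxW (m + 1) F) {Y : Finset ℕ} (hY : Y ⊆ Icc 1 m)
    (h1 : ∀ X ⊆ Icc 1 m, X ∈ F → WSep X Y ∧ (#X ≤ #Y → LD X Y))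
    (h2 : ∀ A ⊆ Icc 1 m, insert (m + 1) A ∈ F → WSep Y A) : insert (m + 1) Y ∈ F := by
  refine h.mem _ (insert_succ_subset hY) fun A hA => ?_
  rcases subset_or_eq_insert (h.sub A hA) with hAm | ⟨A, hAm, rfl⟩
  · exact ((wsep_insert_right hAm hY).2 (h1 A hAm hA)).symm
  · exact (wsep_insert_insert hY hAm).2 (h2 A hAm hA)

lemma left_right (h : MaxW (m + 1) F) {X Y : Finset ℕ} (hX : X ⊆ Icc 1 m) (hY : Y ⊆ Icc 1 m)
    (hXF : X ∈ F) (hYF : insert (m + 1) Y ∈ F) : WSep X Y ∧ (#X ≤ #Y → LD X Y) :=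
  (wsep_insert_right hX hY).1 (h.wsep X hXF _ hYF)

end MaxW

/-- A maximal collection `F` on `{1, …, m + 1}` projects into `G` on `{1, …, m}`, and the chain `B`
separates the members of `F` that avoid `m + 1` from those that contain it. -/
structure PreExp (m : ℕ) (F G : Finset (Finset ℕ)) (B : ℕ → Finset ℕ) : Prop where
  maxF : MaxW (m + 1) F
  maxG : MaxW m G
  left_mem : ∀ X ⊆ Icc 1 m, X ∈ F → X ∈ G
  right_mem : ∀ Y ⊆ Icc 1 m, insert (m + 1) Y ∈ F → Y ∈ G
  sub : ∀ k ≤ m, B k ⊆ Icc 1 m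
  mem_left : ∀ k ≤ m, B k ∈ F
  mem_right : ∀ k ≤ m, insert (m + 1) (B k) ∈ F
  card : ∀ k ≤ m, #(B k) = k
  left_le : ∀ k ≤ m, ∀ X ⊆ Icc 1 m, X ∈ F → #X ≤ k → LD X (B k)
  le_right : ∀ k ≤ m, ∀ Y ⊆ Icc 1 m, insert (m + 1) Y ∈ F → k ≤ #Y → LD (B k) Y

lemma exists_preExp {m : ℕ} {F : Finset (Finset ℕ)} (hP : ∀ G, MaxW m G → Good m G)
    (h : MaxW (m + 1) F) : ∃ G B, PreExp m F G B := by
  classical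
  obtain ⟨G, hG, hHG⟩ := exists_maxW (m := m)
    (G := {X ∈ (Icc 1 m).powerset | X ∈ F ∨ insert (m + 1) X ∈ F})
    (fun X hX => mem_powerset.1 (mem_filter.1 hX).1) (by
      simp only [mem_filter, mem_powerset]
      rintro X ⟨hX, hX' | hX'⟩ Y ⟨hY, hY' | hY'⟩
      · exact h.wsep X hX' Y hY'
      · exact (h.left_right hX hY hX' hY').1
      · exact (h.left_right hY hX hY' hX').1.symm
      · exact (wsep_insert_insert hX hY).1 (h.wsep _ hX' _ hY'))
  have hL : ∀ X ⊆ Icc 1 m, X ∈ F → X ∈ G := fun X hX hXF =>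
    hHG (mem_filter.2 ⟨mem_powerset.2 hX, Or.inl hXF⟩)
  have hR : ∀ X ⊆ Icc 1 m, insert (m + 1) X ∈ F → X ∈ G := fun X hX hXF =>
    hHG (mem_filter.2 ⟨mem_powerset.2 hX, Or.inr hXF⟩)
  have key : ∀ k, ∃ B : Finset ℕ, k ≤ m → B ∈ G ∧ #B = k ∧
      (∀ X ⊆ Icc 1 m, X ∈ F → #X ≤ k → LD X B) ∧
      (∀ Y ⊆ Icc 1 m, insert (m + 1) Y ∈ F → k ≤ #Y → LD B Y) := by
    intro k
    by_cases hk : k ≤ m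
    · obtain ⟨J, hJ, h1, h2⟩ := exists_finset_join (r := Le1) (G := G)
        (T := insert (Icc 1 k) {X ∈ F | X ⊆ Icc 1 m ∧ #X ≤ k}) (fun a => ⟨le_rfl, LD.refl a⟩)
        (fun a ha b _ c hc => hG.le1_trans ha hc) (hP G hG).join (insert_nonempty _ _)
        (insert_subset (hG.icc_left_mem hk) fun X hX => by
          have := mem_filter.1 hX
          exact hL X this.2.1 this.1)
      simp only [mem_insert, mem_filter, forall_eq_or_imp] at h1 h2
      refine ⟨J, fun _ => ⟨hJ, ?_, fun X hX hXF hXk => (h1.2 X ⟨hXF, hX, hXk⟩).2,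
        fun Y hY hYF hYk => (h2 Y (hR Y hY hYF) ⟨⟨by rwa [card_icc_one], LD.icc_left hY⟩,
          fun X hX => ⟨by omega, (h.left_right hX.2.1 hY hX.1 hYF).2 (by omega)⟩⟩).2⟩⟩
      have e1 := h1.1.1
      have e2 := (h2 _ (hG.icc_right_mem (m - k))
        ⟨⟨by rw [card_icc_right hk, card_icc_one], LD.icc_right (Icc_subset_Icc_right hk)⟩,
          fun X hX => ⟨by rw [card_icc_right hk]; omega, LD.icc_right hX.2.1⟩⟩).1
      rw [card_icc_one] at e1
      rw [card_icc_right hk] at e2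
      omega
    · exact ⟨∅, fun h => absurd h hk⟩
  choose B hB using key
  refine ⟨G, B, h, hG, hL, hR, fun k hk => hG.sub _ (hB k hk).1, fun k hk => ?_, fun k hk => ?_,
    fun k hk => (hB k hk).2.1, fun k hk => (hB k hk).2.2.1, fun k hk => (hB k hk).2.2.2⟩
  · obtain ⟨h1, h2, h3, h4⟩ := hB k hk
    exact h.mem_of_left (hG.sub _ h1) (fun A hA hAF => hG.wsep _ h1 A (hL A hA hAF))
      fun Y hY hYF => ⟨hG.wsep _ h1 Y (hR Y hY hYF), fun hc => h4 Y hY hYF (by omega)⟩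
  · obtain ⟨h1, h2, h3, h4⟩ := hB k hk
    exact h.mem_of_right (hG.sub _ h1)
      (fun X hX hXF => ⟨hG.wsep X (hL X hX hXF) _ h1, fun hc => h3 X hX hXF (by omega)⟩)
      fun A hA hAF => hG.wsep _ h1 A (hR A hA hAF)

lemma cpl_succ {m : ℕ} (X : Finset ℕ) (hX : X ⊆ Icc 1 m) :
    cpl (m + 1) X = insert (m + 1) (cpl m X) := by
  have := succ_notMem hX
  ext i
  simp only [mem_cpl, mem_insert]
  grind

lemma cpl_succ_insert {m : ℕ} (X : Finset ℕ) :
    cpl (m + 1) (insert (m + 1) X) = cpl m X := by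
  ext i
  simp only [mem_cpl, mem_insert]
  grind

namespace PreExp
variable {m : ℕ} {F G : Finset (Finset ℕ)} {B : ℕ → Finset ℕ}

lemma cpl (h : PreExp m F G B) :
    PreExp m (F.image (cpl (m + 1))) (G.image (cpl m)) fun k => cpl m (B (m - k)) := by
  have e1 : ∀ X ⊆ Icc 1 m, X ∈ F.image (_root_.cpl (m + 1)) ↔
      insert (m + 1) (_root_.cpl m X) ∈ F := fun X hX => by
    rw [h.maxF.mem_image_cpl (subset_icc_succ hX), cpl_succ X hX]
  have e2 : ∀ X ⊆ Icc 1 m, insert (m + 1) X ∈ F.image (_root_.cpl (m + 1)) ↔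
      _root_.cpl m X ∈ F := fun X hX => by
    rw [h.maxF.mem_image_cpl (insert_succ_subset hX), cpl_succ_insert X]
  have e3 := cpl_subset m
  refine ⟨h.maxF.image_cpl, h.maxG.image_cpl, fun X hX hXF => ?_, fun X hX hXF => ?_,
    fun k hk => cpl_subset _ _, fun k hk => ?_, fun k hk => ?_, fun k hk => ?_,
    fun k hk X hX hXF hc => ?_, fun k hk X hX hXF hc => ?_⟩
  · rw [h.maxG.mem_image_cpl hX]
    exact h.right_mem _ (e3 X) ((e1 X hX).1 hXF)
  · rw [h.maxG.mem_image_cpl hX]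
    exact h.left_mem _ (e3 X) ((e2 X hX).1 hXF)
  · rw [e1 _ (e3 _), cpl_cpl (h.sub _ (by omega))]
    exact h.mem_right _ (by omega)
  · rw [e2 _ (e3 _), cpl_cpl (h.sub _ (by omega))]
    exact h.mem_left _ (by omega)
  · have := card_cpl (h.sub (m - k) (by omega))
    have := h.card (m - k) (by omega)
    omega
  · have h1 := card_cpl hX
    have := h.le_right (m - k) (by omega) _ (e3 X) ((e1 X hX).1 hXF) (by omega)
    rwa [← ld_cpl (e3 _) (h.sub _ (by omega)), cpl_cpl hX] at this
  · have h1 := card_cpl hX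
    have := h.left_le (m - k) (by omega) _ (e3 X) ((e2 X hX).1 hXF) (by omega)
    rwa [← ld_cpl (h.sub _ (by omega)) (e3 _), cpl_cpl hX] at this

variable (hP : ∀ G, MaxW m G → Good m G)
include hP

lemma not_sur_left (h : PreExp m F G B) {Z : Finset ℕ} (hZ : Z ∈ G) : ¬ Sur (B #Z) Z := by
  intro hS
  have hG := h.maxG
  have hk := hG.card_le hZ
  set k := #Z with hkdef
  have hU := h.left_mem _ (h.sub k hk) (h.mem_left k hk)
  have hUc := h.card k hk
  obtain ⟨a, ha, a₁, a₂, h1, h2, h3, h4, h5, h6, h7⟩ := (hP G hG).exchange _ hU Z hZ hS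
  have hSc := card_erase_add_one ha
  have hk1 : 1 ≤ k := by omega
  have hLs : ∀ X ⊆ Icc 1 m, X ∈ F → WSep X ((B k).erase a) := fun X hX hXF => by
    by_contra hc
    have := h7 X (h.left_mem X hX hXF) hc
    exact this.2.2.2 (h.left_le k hk X hX hXF (by rw [← this.1, hUc]))
  have hRs : ∀ X ⊆ Icc 1 m, insert (m + 1) X ∈ F → WSep X ((B k).erase a) := fun X hX hXF => by
    by_contra hc
    have := h7 X (h.right_mem X hX hXF) hc
    exact this.2.2.1 (h.le_right k hk X hX hXF (by rw [← this.1, hUc]))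
  have hk' : k - 1 ≤ m := by omega
  have hcF := h.mem_left (k - 1) hk'
  have hcG := h.left_mem _ (h.sub _ hk') hcF
  have hcc := h.card (k - 1) hk'
  have hcS : LD (B (k - 1)) ((B k).erase a) := by
    rcases LD.ld_or_subset_of_insert (c := B (k - 1)) (S := (B k).erase a) (a := a) (a2 := a₂)
      (notMem_erase _ _) (fun hh => h2 (mem_of_mem_erase hh)) h4 (by omega)
      (by rw [insert_erase ha]; exact h.left_le k hk _ (h.sub _ hk') hcF (by omega))
      (hG.wsep _ hcG _ h6) with hh | hh
    · exact hh
    · rw [insert_erase ha] at hh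
      exact absurd (hG.wsep _ hcG _ hZ) (hS.not_wsep_of_subset hh (by omega))
  have hSm : (B k).erase a ⊆ Icc 1 m := (erase_subset _ _).trans (h.sub k hk)
  have hSF : insert (m + 1) ((B k).erase a) ∈ F :=
    h.maxF.mem_of_right hSm
      (fun X hX hXF => ⟨hLs X hX hXF, fun hc => LD.trans_of_le
        (h.left_le (k - 1) hk' X hX hXF (by omega)) hcS (hLs X hX hXF) (by omega) (by omega)⟩)
      fun A hA hAF => (hRs A hA hAF).symm
  exact hS.not_wsep_erase ha (hG.wsep _ (h.right_mem _ hSm hSF) _ hZ)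

lemma not_sur_right (h : PreExp m F G B) {Z : Finset ℕ} (hZ : Z ∈ G) : ¬ Sur Z (B #Z) := by
  intro hS
  have hG := h.maxG
  have hk := hG.card_le hZ
  have hZs := hG.sub Z hZ
  have hc := card_cpl hZs
  have := h.cpl.not_sur_left hP (Z := _root_.cpl m Z) (mem_image_of_mem _ hZ)
  rw [show m - #(_root_.cpl m Z) = #Z by omega, sur_cpl (h.sub _ hk) hZs] at this
  exact this hS

end PreExp

/-- The decomposition of a maximal collection `F` on `{1, …, m + 1}` by a maximal collection `G` on
`{1, …, m}` and a maximal chain `B` in `G`. -/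
structure Exp (m : ℕ) (F G : Finset (Finset ℕ)) (B : ℕ → Finset ℕ) : Prop where
  maxF : MaxW (m + 1) F
  maxG : MaxW m G
  B_mem : ∀ k ≤ m, B k ∈ G
  B_card : ∀ k ≤ m, #(B k) = k
  B_le : ∀ k ≤ m, ∀ j ≤ k, LD (B j) (B k)
  mem_left : ∀ X ⊆ Icc 1 m, (X ∈ F ↔ X ∈ G ∧ LD X (B #X))
  mem_right : ∀ Y ⊆ Icc 1 m, (insert (m + 1) Y ∈ F ↔ Y ∈ G ∧ LD (B #Y) Y)
  total : ∀ X ∈ G, LD X (B #X) ∨ LD (B #X) X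

lemma exists_exp {m : ℕ} {F : Finset (Finset ℕ)} (hP : ∀ G, MaxW m G → Good m G)
    (hF : MaxW (m + 1) F) : ∃ G B, Exp m F G B := by
  obtain ⟨G, B, h⟩ := exists_preExp hP hF
  have hG := h.maxG
  have hB : ∀ k ≤ m, B k ∈ G := fun k hk => h.left_mem _ (h.sub k hk) (h.mem_left k hk)
  refine ⟨G, B, h.maxF, hG, hB, h.card, fun k hk j hj => h.left_le k hk _ (h.sub j (hj.trans hk))
      (h.mem_left j (hj.trans hk)) ((h.card j (hj.trans hk)).trans_le hj),
    fun X hX => ⟨fun hXF => ⟨h.left_mem X hX hXF, ?_⟩, fun ⟨hXG, hL⟩ => ?_⟩,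
    fun X hX => ⟨fun hXF => ⟨h.right_mem X hX hXF, ?_⟩, fun ⟨hXG, hL⟩ => ?_⟩, fun X hX => ?_⟩
  · exact h.left_le _ (hG.card_le (h.left_mem X hX hXF)) X hX hXF le_rfl
  · refine hF.mem_of_left hX (fun A hA hAF => hG.wsep _ hXG A (h.left_mem A hA hAF))
      fun Y hY hYF => ⟨hG.wsep _ hXG Y (h.right_mem Y hY hYF), fun hc => ?_⟩
    have hc' := h.card _ (hG.card_le hXG)
    exact hG.trans_le hXG (h.right_mem Y hY hYF) hL (h.le_right _ (hG.card_le hXG) Y hY hYF hc)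
      hc'.ge (by omega)
  · exact h.le_right _ (hG.card_le (h.right_mem X hX hXF)) X hX hXF le_rfl
  · refine hF.mem_of_right hX
      (fun A hA hAF => ⟨hG.wsep A (h.left_mem A hA hAF) _ hXG, fun hc => ?_⟩)
      fun Y hY hYF => hG.wsep _ hXG Y (h.right_mem Y hY hYF)
    have hc' := h.card _ (hG.card_le hXG)
    exact hG.trans_le (h.left_mem A hA hAF) hXG (h.left_le _ (hG.card_le hXG) A hA hAF hc) hL
      (by omega) (by omega)
  · have hc := h.card _ (hG.card_le hX)
    rcases (hG.wsep X hX _ (hB _ (hG.card_le hX))).cases_of_card_eq hc.symm with h' | h' | h' | h'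
    · exact Or.inl h'
    · exact Or.inr h'
    · exact absurd h' (h.not_sur_right hP hX)
    · exact absurd h' (h.not_sur_left hP hX)

lemma Exp.card_eq {m : ℕ} {F G : Finset (Finset ℕ)} {B : ℕ → Finset ℕ} (h : Exp m F G B) :
    #F = #G + (m + 1) := by
  classical
  have hG := h.maxG
  set L := {X ∈ G | LD X (B #X)} with hL
  set R := {X ∈ G | LD (B #X) X} with hR
  have e1 : F = L ∪ R.image (insert (m + 1)) := by
    ext A
    simp only [mem_union, mem_image, hL, hR, mem_filter]
    constructor
    · intro hA
      rcases subset_or_eq_insert (h.maxF.sub A hA) with hAm | ⟨Y, hY, rfl⟩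
      · exact Or.inl ((h.mem_left A hAm).1 hA)
      · exact Or.inr ⟨Y, (h.mem_right Y hY).1 hA, rfl⟩
    · rintro (hA | ⟨Y, hY, rfl⟩)
      · exact (h.mem_left A (hG.sub A hA.1)).2 hA
      · exact (h.mem_right Y (hG.sub Y hY.1)).2 hY
  have e2 : Disjoint L (R.image (insert (m + 1))) := by
    rw [disjoint_left]
    intro A hA hA'
    obtain ⟨Y, -, rfl⟩ := mem_image.1 hA'
    exact succ_notMem (hG.sub _ (mem_filter.1 hA).1) (mem_insert_self _ _)
  have e3 : #(R.image (insert (m + 1))) = #R := card_image_of_injOn fun X hX Y hY e =>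
    insert_succ_inj (hG.sub _ (mem_filter.1 hX).1) (hG.sub _ (mem_filter.1 hY).1) e
  have e4 : L ∪ R = G := by
    rw [hL, hR, ← filter_or, filter_true_of_mem h.total]
  have e5 : L ∩ R = (range (m + 1)).image B := by
    ext X
    simp only [hL, hR, mem_inter, mem_filter, mem_image, mem_range]
    constructor
    · rintro ⟨⟨h1, h2⟩, -, h3⟩
      exact ⟨#X, Nat.lt_succ_of_le (hG.card_le h1), h3.antisymm h2 (h.B_card _ (hG.card_le h1))⟩
    · rintro ⟨k, hk, rfl⟩
      have hk' : k ≤ m := by omega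
      rw [h.B_card k hk']
      exact ⟨⟨h.B_mem k hk', LD.refl _⟩, h.B_mem k hk', LD.refl _⟩
  have e6 : #((range (m + 1)).image B) = m + 1 := by
    rw [card_image_of_injOn, card_range]
    intro i hi j hj e
    simp only [coe_range, Set.mem_Iio] at hi hj
    have := congrArg card e
    rwa [h.B_card i (by omega), h.B_card j (by omega)] at this
  have e7 := card_union_add_card_inter L R
  rw [e4, e5, e6] at e7
  rw [e1, card_union_of_disjoint e2, e3]
  omega

lemma MaxW.exists_join {m : ℕ} {G : Finset (Finset ℕ)} (hP : ∀ G, MaxW m G → Good m G)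
    (h : MaxW m G) {X₁ X₂ : Finset ℕ} (h₁ : X₁ ∈ G) (h₂ : X₂ ∈ G) (hc : #X₂ ≤ #X₁) :
    ∃ J ∈ G, #J = #X₁ ∧ LD X₁ J ∧ LD X₂ J ∧
      ∀ Y ∈ G, #X₁ ≤ #Y → LD X₁ Y → LD X₂ Y → LD J Y := by
  obtain ⟨J, hJ, hJ1, hJ2, hJ3⟩ := (hP _ h).join _ h₁ _ h₂
  have hk := h.card_le h₁
  have hf := card_icc_right hk
  have := (hJ3 _ (h.icc_right_mem (m - #X₁)) ⟨hf.ge, LD.icc_right (h.sub _ h₁)⟩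
    ⟨by omega, LD.icc_right (h.sub _ h₂)⟩).1
  exact ⟨J, hJ, le_antisymm (by omega) hJ1.1, hJ1.2, hJ2.2, fun Y hY hcY hL1 hL2 =>
    (hJ3 Y hY ⟨hcY, hL1⟩ ⟨hc.trans hcY, hL2⟩).2⟩

namespace Exp
variable {m : ℕ} {F G : Finset (Finset ℕ)} {B : ℕ → Finset ℕ}

lemma sub_B (h : Exp m F G B) {k : ℕ} (hk : k ≤ m) : B k ⊆ Icc 1 m := h.maxG.sub _ (h.B_mem k hk)

lemma left (h : Exp m F G B) {X : Finset ℕ} (hX : X ∈ G) (hL : LD X (B #X)) : X ∈ F :=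
  (h.mem_left X (h.maxG.sub X hX)).2 ⟨hX, hL⟩

lemma right (h : Exp m F G B) {Y : Finset ℕ} (hY : Y ∈ G) (hL : LD (B #Y) Y) :
    insert (m + 1) Y ∈ F :=
  (h.mem_right Y (h.maxG.sub Y hY)).2 ⟨hY, hL⟩

lemma cases (h : Exp m F G B) {A : Finset ℕ} (hA : A ∈ F) :
    (A ∈ G ∧ LD A (B #A)) ∨ ∃ Y ∈ G, LD (B #Y) Y ∧ A = insert (m + 1) Y := by
  rcases subset_or_eq_insert (h.maxF.sub A hA) with hAm | ⟨Y, hY, rfl⟩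
  · exact Or.inl ((h.mem_left A hAm).1 hA)
  · have := (h.mem_right Y hY).1 hA
    exact Or.inr ⟨Y, this.1, this.2, rfl⟩

lemma left_le (h : Exp m F G B) {X : Finset ℕ} (hX : X ∈ G) (hL : LD X (B #X)) {k : ℕ}
    (hk : #X ≤ k) (hkm : k ≤ m) : LD X (B k) :=
  h.maxG.trans_le hX (h.B_mem k hkm) hL (h.B_le k hkm _ hk)
    (h.B_card _ (hk.trans hkm)).ge (by rw [h.B_card _ (hk.trans hkm), h.B_card k hkm]; exact hk)

lemma le_right (h : Exp m F G B) {Y : Finset ℕ} (hY : Y ∈ G) (hL : LD (B #Y) Y) {k : ℕ}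
    (hk : k ≤ #Y) : LD (B k) Y := by
  have hYm := h.maxG.card_le hY
  exact h.maxG.trans_le (h.B_mem k (hk.trans hYm)) hY (h.B_le _ hYm _ hk) hL
    (by rw [h.B_card _ hYm, h.B_card k (hk.trans hYm)]; exact hk) (h.B_card _ hYm).le

lemma left_right (h : Exp m F G B) {X Y : Finset ℕ} (hX : X ∈ G) (hL : LD X (B #X)) (hY : Y ∈ G)
    (hR : LD (B #Y) Y) (hc : #X ≤ #Y) : LD X Y :=
  (h.maxF.left_right (h.maxG.sub X hX) (h.maxG.sub Y hY) (h.left hX hL) (h.right hY hR)).2 hc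

lemma B_cmp (h : Exp m F G B) {k : ℕ} (hk : k ≤ m) :
    ∀ z ∈ G, #z = #(B k) → LD (B k) z ∨ LD z (B k) := fun z hz hc => by
  have := h.total z hz
  rw [hc, h.B_card k hk] at this
  exact this.symm

/-- Upper bounds of a member containing `m + 1` contain `m + 1`. -/
lemma exists_of_le1_insert (h : Exp m F G B) {Y V : Finset ℕ} (hY : Y ∈ G) (hV : V ∈ F)
    (hle : Le1 (insert (m + 1) Y) V) :
    ∃ W ∈ G, LD (B #W) W ∧ V = insert (m + 1) W ∧ Le1 Y W := by
  have hYm := h.maxG.sub Y hY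
  obtain ⟨hc, hL⟩ := hle
  rw [card_insert_succ hYm] at hc
  rcases h.cases hV with ⟨hVG, -⟩ | ⟨W, hW, hRW, rfl⟩
  · have := card_le_card (subset_of_ld_insert_left (h.maxG.sub V hVG) hL)
    omega
  · have hWm := h.maxG.sub W hW
    rw [card_insert_succ hWm] at hc
    rw [ld_insert_insert hYm hWm] at hL
    exact ⟨W, hW, hRW, rfl, by omega, hL⟩

lemma le1_insert_insert (h : Exp m F G B) {X Y : Finset ℕ} (hX : X ∈ G) (hY : Y ∈ G)
    (hle : Le1 X Y) : Le1 (insert (m + 1) X) (insert (m + 1) Y) := by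
  have hXm := h.maxG.sub X hX
  have hYm := h.maxG.sub Y hY
  refine ⟨?_, (ld_insert_insert hXm hYm).2 hle.2⟩
  rw [card_insert_succ hXm, card_insert_succ hYm]
  exact Nat.succ_le_succ hle.1

variable (hP : ∀ G, MaxW m G → Good m G)

include hP

lemma exists_B_erase (h : Exp m F G B) {k : ℕ} (hk : k ≤ m) (hk0 : 1 ≤ k) :
    ∃ a ∈ B k, (B k).erase a ∈ G ∧ #((B k).erase a) + 1 = k := by
  have hc := h.B_card k hk
  obtain ⟨a, ha, haG⟩ := h.maxG.exists_erase_mem hP (h.B_mem k hk) (card_pos.1 (by omega))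
    (h.B_cmp hk)
  exact ⟨a, ha, haG, by rw [card_erase_add_one ha, hc]⟩

lemma exists_B_insert (h : Exp m F G B) {k : ℕ} (hk : k < m) :
    ∃ x, x ∉ B k ∧ insert x (B k) ∈ G ∧ #(insert x (B k)) = k + 1 ∧
      ∀ z ∈ G, #z = k + 1 → LD (B k) z → LD (insert x (B k)) z := by
  have hc := h.B_card k hk.le
  obtain ⟨x, hx, hxG, h1⟩ := h.maxG.exists_insert_mem hP (h.B_mem k hk.le) (by omega)
    (h.B_cmp hk.le)
  exact ⟨x, hx, hxG, by rw [card_insert_of_notMem hx, hc], fun z hz hzc => h1 z hz (by omega)⟩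

lemma hasJoin_left (h : Exp m F G B) {X₁ X₂ : Finset ℕ} (h₁ : X₁ ∈ G) (hL₁ : LD X₁ (B #X₁))
    (h₂ : X₂ ∈ G) (hL₂ : LD X₂ (B #X₂)) (hc : #X₂ ≤ #X₁) : HasJoin F X₁ X₂ := by
  have hG := h.maxG
  have hs := hG.card_le h₁
  obtain ⟨J, hJ, hJc, hJ1, hJ2, hJ3⟩ := hG.exists_join hP h₁ h₂ hc
  have hBs := h.B_card _ hs
  refine ⟨J, h.left hJ ?_, ⟨hJc.ge, hJ1⟩, ⟨by omega, hJ2⟩, fun V hV hV1 hV2 => ?_⟩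
  · rw [hJc]
    exact hJ3 _ (h.B_mem _ hs) hBs.ge hL₁ (h.left_le h₂ hL₂ hc hs)
  rcases h.cases hV with ⟨hVG, -⟩ | ⟨W, hW, hRW, rfl⟩
  · exact ⟨hJc.trans_le hV1.1, hJ3 V hVG hV1.1 hV1.2 hV2.2⟩
  have hWm := hG.sub W hW
  obtain ⟨hc1, hL1⟩ := hV1
  obtain ⟨hc2, hL2⟩ := hV2
  rw [card_insert_succ hWm] at hc1 hc2
  rw [ld_insert_right (hG.sub _ h₁)] at hL1
  rw [ld_insert_right (hG.sub _ h₂)] at hL2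
  refine ⟨by rw [card_insert_succ hWm]; omega, (ld_insert_right (hG.sub _ hJ)).2 ?_⟩
  by_cases hcW : #X₁ ≤ #W
  · exact hJ3 W hW hcW hL1 hL2
  have hWs : #W + 1 = #X₁ := by omega
  obtain ⟨z, hz, hzc, hzW, hzmax⟩ := hG.exists_greatest_le hP hW (s := #X₁) (by omega) hs
  have hX2z : LD X₂ z := by
    by_cases hc3 : #X₂ = #X₁
    · exact hzmax _ h₂ hc3 hL2
    · obtain ⟨x, hx, hxG, hxc, -⟩ := h.exists_B_insert hP (k := #W) (by omega)
      have hcB := h.B_card #W (by omega)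
      have e1 : LD X₂ (insert x (B #W)) :=
        hG.trans_le h₂ hxG (h.left_le h₂ hL₂ (by omega) (by omega))
          (LD.of_subset (subset_insert _ _)) (by omega) (by omega)
      have e2 : LD (insert x (B #W)) W :=
        hG.trans_ge hxG hW (LD.of_superset (subset_insert _ _)) hRW (by omega) (by omega)
      exact hG.trans_le h₂ hz e1 (hzmax _ hxG (by omega) e2) (by omega) (by omega)
  exact hG.trans_ge hJ hW (hJ3 z hz hzc.ge (hzmax _ h₁ rfl hL1) hX2z) hzW (by omega) (by omega)

lemma hasJoin_right (h : Exp m F G B) {Y₁ Y₂ : Finset ℕ} (h₁ : Y₁ ∈ G) (h₂ : Y₂ ∈ G)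
    (hc : #Y₂ ≤ #Y₁) : HasJoin F (insert (m + 1) Y₁) (insert (m + 1) Y₂) := by
  have hG := h.maxG
  have hs := hG.card_le h₁
  obtain ⟨J, hJ, hJc, hJ1, hJ2, hJ3⟩ := hG.exists_join hP h₁ h₂ hc
  have hBs := h.B_card _ hs
  rcases h.total J hJ with hJB | hJB
  · rw [hJc] at hJB
    refine ⟨_, h.right (h.B_mem _ hs) (by rw [hBs]; exact LD.refl _),
      h.le1_insert_insert h₁ (h.B_mem _ hs) ⟨hBs.ge, ?_⟩,
      h.le1_insert_insert h₂ (h.B_mem _ hs) ⟨by omega, ?_⟩, fun V hV hV1 hV2 => ?_⟩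
    · exact hG.trans_le h₁ (h.B_mem _ hs) hJ1 hJB hJc.ge (by omega)
    · exact hG.trans_le h₂ (h.B_mem _ hs) hJ2 hJB (by omega) (by omega)
    · obtain ⟨W, hW, hRW, rfl, hle⟩ := h.exists_of_le1_insert h₁ hV hV1
      exact h.le1_insert_insert (h.B_mem _ hs) hW ⟨by rw [hBs]; exact hle.1,
        h.le_right hW hRW hle.1⟩
  · refine ⟨_, h.right hJ hJB, h.le1_insert_insert h₁ hJ ⟨hJc.ge, hJ1⟩,
      h.le1_insert_insert h₂ hJ ⟨by omega, hJ2⟩, fun V hV hV1 hV2 => ?_⟩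
    obtain ⟨W, hW, hRW, rfl, hle⟩ := h.exists_of_le1_insert h₁ hV hV1
    obtain ⟨W', hW', -, e, hle'⟩ := h.exists_of_le1_insert h₂ hV hV2
    have e' : W' = W := (insert_succ_inj (hG.sub W hW) (hG.sub W' hW') e).symm
    subst e'
    exact h.le1_insert_insert hJ hW' ⟨by rw [hJc]; exact hle.1, hJ3 _ hW' hle.1 hle.2 hle'.2⟩

lemma hasJoin_left_right (h : Exp m F G B) {X Y : Finset ℕ} (hX : X ∈ G) (hL : LD X (B #X))
    (hY : Y ∈ G) (hR : LD (B #Y) Y) : HasJoin F X (insert (m + 1) Y) := by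
  have hG := h.maxG
  have hXm := hG.sub X hX
  have hYm := hG.sub Y hY
  have hs := hG.card_le hX
  rcases Nat.lt_or_ge #Y #X with hc | hc
  · obtain ⟨t, ht⟩ : ∃ t, #X = t + 1 := ⟨#X - 1, by omega⟩
    have htm : t ≤ m := by omega
    have hBt := h.B_card t htm
    have hBtG := h.B_mem t htm
    obtain ⟨J₁, hJ, hJc, hJ1, hJ2, hJ3⟩ := hG.exists_join hP hBtG hY (by omega)
    obtain ⟨w, hw, hwc, hXw, hwmin⟩ := hG.exists_least_ge_of_le
      (fun G hG => (hP G hG).join) hX (t := t) (by omega)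
    obtain ⟨W₂, hW₂, hWc, hW1, hW2, hW3⟩ := hG.exists_join hP hJ hw (by omega)
    refine ⟨_, h.right hW₂ ?_, ⟨?_, (ld_insert_right hXm).2 ?_⟩,
      h.le1_insert_insert hY hW₂ ⟨by omega, ?_⟩, fun V hV hV1 hV2 => ?_⟩
    · rw [show #W₂ = t by omega]
      exact hG.trans_le hBtG hW₂ hJ1 hW1 (by omega) (by omega)
    · rw [card_insert_succ (hG.sub _ hW₂)]
      omega
    · exact hG.trans_ge hX hW₂ hXw hW2 (by omega) (by omega)
    · exact hG.trans_le hY hW₂ hJ2 hW1 (by omega) (by omega)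
    · obtain ⟨W, hW, hRW, rfl, hle⟩ := h.exists_of_le1_insert hY hV hV2
      obtain ⟨hc1, hL1⟩ := hV1
      rw [card_insert_succ (hG.sub _ hW)] at hc1
      rw [ld_insert_right hXm] at hL1
      have hBW : LD (B t) W := h.le_right hW hRW (by omega)
      have hwW : LD w W := by
        by_cases hcW : #W = t
        · exact hwmin W hW hcW.le hL1
        · obtain ⟨a, ha, haG, hac⟩ := h.exists_B_erase hP (k := t + 1) (by omega) (by omega)
          have hBc := h.B_card (t + 1) (by omega)
          rw [ht] at hL
          have e1 : LD w ((B (t + 1)).erase a) := hwmin _ haG (by omega)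
            (hG.trans_ge hX haG hL (LD.of_superset (erase_subset _ _)) (by omega) (by omega))
          have e2 := hG.trans_le hw (h.B_mem (t + 1) (by omega)) e1
            (LD.of_subset (erase_subset _ _)) (by omega) (by omega)
          exact hG.trans_le hw hW e2 (h.le_right hW hRW (by omega)) (by omega) (by omega)
      exact h.le1_insert_insert hW₂ hW ⟨by omega,
        hW3 W hW (by omega) (hJ3 W hW (by omega) hBW hle.2) hwW⟩
  · refine ⟨_, h.right hY hR, ⟨?_, (ld_insert_right hXm).2 (h.left_right hX hL hY hR hc)⟩,
      ⟨le_rfl, LD.refl _⟩, fun V hV hV1 hV2 => hV2⟩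
    rw [card_insert_succ hYm]
    omega

lemma hasJoin (h : Exp m F G B) {X₁ X₂ : Finset ℕ} (h₁ : X₁ ∈ F) (h₂ : X₂ ∈ F) :
    HasJoin F X₁ X₂ := by
  rcases h.cases h₁ with ⟨g₁, l₁⟩ | ⟨Y₁, g₁, l₁, rfl⟩ <;>
    rcases h.cases h₂ with ⟨g₂, l₂⟩ | ⟨Y₂, g₂, l₂, rfl⟩
  · rcases le_total #X₂ #X₁ with hc | hc
    · exact h.hasJoin_left hP g₁ l₁ g₂ l₂ hc
    · exact (h.hasJoin_left hP g₂ l₂ g₁ l₁ hc).symm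
  · exact h.hasJoin_left_right hP g₁ l₁ g₂ l₂
  · exact (h.hasJoin_left_right hP g₂ l₂ g₁ l₁).symm
  · rcases le_total #Y₂ #Y₁ with hc | hc
    · exact h.hasJoin_right hP g₁ g₂ hc
    · exact (h.hasJoin_right hP g₂ g₁ hc).symm

end Exp

lemma card_insert_erase {U : Finset ℕ} {a x : ℕ} (ha : a ∈ U) (hx : x ∉ U) :
    #(insert x (U.erase a)) = #U := by
  rw [card_insert_of_notMem fun h => hx (mem_of_mem_erase h), card_erase_add_one ha]

lemma ld_insert_erase_left {U : Finset ℕ} {a x : ℕ} (hxa : x < a) :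
    LD (insert x (U.erase a)) U := by
  intro p hp hpU q hq hqU
  have e1 : p = x := by grind
  have e2 : q = a := by grind
  omega

lemma ld_insert_erase_right {U : Finset ℕ} {a x : ℕ} (hxa : a < x) :
    LD U (insert x (U.erase a)) := by
  intro p hp hpU q hq hqU
  have e1 : p = a := by grind
  have e2 : q = x := by grind
  omega

lemma LD.subset_of_erase {Y c : Finset ℕ} {a : ℕ} (h1 : LD (Y.erase a) c) (h2 : LD c Y)
    (h3 : ¬ LD c (Y.erase a)) (hc : #c ≤ #(Y.erase a)) : c ⊆ Y := by
  intro p hp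
  by_contra hpY
  by_cases hs : Y.erase a ⊆ c
  · rw [eq_of_subset_of_card_le hs hc] at h3
    exact h3 (LD.refl c)
  · obtain ⟨s, hs, hsc⟩ := not_subset.1 hs
    have e1 := h1 s hs hsc p hp fun h => hpY (mem_of_mem_erase h)
    have e2 := h2 p hp hpY s (mem_of_mem_erase hs) hsc
    omega

namespace Exp
variable {m : ℕ} {F G : Finset (Finset ℕ)} {B : ℕ → Finset ℕ}

lemma left_le_of_not_sur (h : Exp m F G B) {X : Finset ℕ} (hX : X ∈ G) (hL : LD X (B #X)) {t : ℕ}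
    (ht : #X = t + 1) (hS : ¬ Sur X (insert (m + 1) (B t))) : LD X (B t) := by
  have hXm := h.maxG.sub X hX
  have hk := h.maxG.card_le hX
  have hB := h.B_mem t (by omega)
  have hBm := h.maxG.sub _ hB
  have hBc := h.B_card t (by omega)
  have hsep := h.maxF.wsep X (h.left hX hL) _ (h.right hB (by rw [hBc]; exact LD.refl _))
  rcases hsep.cases_of_card_eq (by rw [card_insert_succ hBm]; omega) with h' | h' | h' | h'
  · exact (ld_insert_right hXm).1 h'
  · have := card_le_card (subset_of_ld_insert_left hXm h')
    omega
  · exact absurd h' hS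
  · exact (cv_insert_left hXm).1 h'.2.1

lemma not_sur_of_left (h : Exp m F G B) {X : Finset ℕ} (hX : X ∈ G) (hL : LD X (B #X))
    (hS : ∀ Z ∈ F, ¬ Sur X Z) : ∀ Z ∈ G, ¬ Sur X Z := by
  intro Z hZ hXZ
  have hk := h.maxG.card_le hX
  have hBc := h.B_card _ hk
  rcases h.total Z hZ with h' | h'
  · exact hS Z (h.left hZ h') hXZ
  · rw [← hXZ.1] at h'
    exact hXZ.2.2.1 (h.maxG.trans_le hX hZ hL h' hBc.ge (by rw [hBc]; exact hXZ.1.le))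

lemma not_sur_of_right (h : Exp m F G B) {Y : Finset ℕ} (hY : Y ∈ G) (hR : LD (B #Y) Y)
    (hS : ∀ Z ∈ F, ¬ Sur (insert (m + 1) Y) Z) : ∀ Z ∈ G, ¬ Sur Y Z := by
  intro Z hZ hYZ
  have hk := h.maxG.card_le hY
  have hBc := h.B_card _ hk
  rcases h.total Z hZ with h' | h'
  · rw [← hYZ.1] at h'
    exact hYZ.2.2.2 (h.maxG.trans_le hZ hY h' hR (by rw [hBc]; exact hYZ.1.ge) hBc.le)
  · exact hS _ (h.right hZ h') ((sur_insert_insert (h.maxG.sub _ hY) (h.maxG.sub _ hZ)).2 hYZ)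

variable (hP : ∀ G, MaxW m G → Good m G)
include hP

lemma hasDescend_left (hJ : ∀ F, MaxW (m + 1) F → ∀ X₁ ∈ F, ∀ X₂ ∈ F, HasJoin F X₁ X₂)
    (h : Exp m F G B) {X : Finset ℕ} (hX : X ∈ G) (hL : LD X (B #X)) (hne : X.Nonempty)
    (hS : ∀ Z ∈ F, ¬ Sur X Z) : HasDescend F X := by
  have hG := h.maxG
  have hk := hG.card_le hX
  have hBc := h.B_card _ hk
  obtain ⟨a, ha, hSG, hmin, halt⟩ :=
    (hP G hG).descend X hX hne (h.not_sur_of_left hX hL hS)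
  have hc := card_erase_add_one ha
  have hBt := h.B_mem #(X.erase a) (by omega)
  have hBtc := h.B_card #(X.erase a) (by omega)
  have hXB := h.left_le_of_not_sur hX hL hc.symm
    (hS _ (h.right hBt (by rw [hBtc]; exact LD.refl _)))
  have hSF : X.erase a ∈ F := h.left hSG (hmin _ hBt (by omega) hXB)
  refine ⟨a, ha, hSF, fun z hz hzc hLz => ?_, halt.imp_right ?_⟩
  · obtain ⟨w, hw, hwc, hXw, hwmin⟩ := h.maxF.exists_least_ge_of_le hJ (h.left hX hL)
      (t := #(X.erase a)) (by omega)
    have hwS := hwmin _ hSF le_rfl (LD.of_superset (erase_subset _ _))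
    rcases h.cases hw with ⟨hwG, -⟩ | ⟨W, hW, -, rfl⟩
    · rw [(hmin w hwG (by omega) hXw).antisymm hwS hwc.symm]
      exact hwmin z hz (by omega) hLz
    · have e1 := card_le_card (subset_of_ld_insert_left (hG.sub _ hSG) hwS)
      rw [card_insert_succ (hG.sub W hW)] at hwc
      omega
  · rintro ⟨a₁, h1, h2, h3⟩
    have hc1 := card_insert_erase ha h2
    refine ⟨a₁, h1, h2, h.left h3 ?_⟩
    rw [hc1]
    exact hG.trans_le h3 (h.B_mem _ hk) (ld_insert_erase_left h1) hL hc1.le hBc.ge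

lemma hasDescend_right_B (h : Exp m F G B) {t : ℕ} (ht : t ≤ m) :
    HasDescend F (insert (m + 1) (B t)) := by
  have hG := h.maxG
  have hY := h.B_mem t ht
  have hYm := hG.sub _ hY
  have hYc := h.B_card t ht
  have hn := succ_notMem hYm
  have hcU := card_insert_succ hYm
  unfold HasDescend
  rw [hcU]
  refine ⟨m + 1, mem_insert_self _ _, ?_, ?_, ?_⟩ <;> rw [erase_insert hn]
  · exact h.left hY (by rw [hYc]; exact LD.refl _)
  · intro z hz hzc hLz
    rcases h.cases hz with ⟨hzG, -⟩ | ⟨W, hW, -, rfl⟩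
    · rw [eq_of_subset_of_card_le (subset_of_ld_insert_left (hG.sub z hzG) hLz) (by omega)]
      exact LD.refl _
    · rw [ld_insert_right hYm]
      exact (ld_insert_insert hYm (hG.sub W hW)).1 hLz
  · rcases ht.lt_or_eq with hlt | rfl
    · right
      obtain ⟨x, hx, hxG, hxc, hxmin⟩ := h.exists_B_insert hP hlt
      have hxm := lt_succ_of_mem (hG.sub _ hxG) (mem_insert_self x _)
      refine ⟨x, hxm, ?_, h.left hxG ?_⟩
      · simp only [mem_insert, not_or]
        exact ⟨by omega, hx⟩
      · rw [hxc]
        exact hxmin _ (h.B_mem _ (by omega)) (h.B_card _ (by omega))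
          (h.B_le _ (by omega) _ (by omega))
    · left
      have e : B t = Icc 1 t := eq_of_subset_of_card_le hYm (by rw [hYc, card_icc_one])
      refine ⟨by rw [e, card_icc_one]; simp, ?_⟩
      rw [hYc, e]
      ext i
      simp only [mem_insert, mem_Icc]
      omega

lemma hasDescend_right (h : Exp m F G B) {Y : Finset ℕ} (hY : Y ∈ G) (hR : LD (B #Y) Y)
    (hS : ∀ Z ∈ F, ¬ Sur (insert (m + 1) Y) Z) : HasDescend F (insert (m + 1) Y) := by
  have hG := h.maxG
  have hYm := hG.sub _ hY
  have ht := hG.card_le hY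
  have hb := h.B_mem _ ht
  have hbc := h.B_card _ ht
  by_cases hYB : Y = B #Y
  · rw [hYB]
    exact h.hasDescend_right_B hP ht
  have hYb : ¬ LD Y (B #Y) := fun hh => hYB (hh.antisymm hR hbc.symm)
  have hne : Y.Nonempty := by
    rw [nonempty_iff_ne_empty]
    rintro rfl
    exact hYb fun _ hx => absurd hx (notMem_empty _)
  obtain ⟨a, ha, hSG, hmin, halt⟩ := (hP G hG).descend Y hY hne (h.not_sur_of_right hY hR hS)
  have hc := card_erase_add_one ha
  set t := #(Y.erase a) with htdef
  have hcG := h.B_mem t (by omega)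
  have hcc := h.B_card t (by omega)
  have hcU := card_insert_succ hYm
  have herase : ∀ s ∈ Y, (insert (m + 1) Y).erase s = insert (m + 1) (Y.erase s) := fun s hs => by
    have := lt_succ_of_mem hYm hs
    exact erase_insert_of_ne (by omega)
  have hlow : ∀ z ∈ F, #z = #Y → LD (insert (m + 1) Y) z →
      ∃ W ∈ G, #W = t ∧ LD (B t) W ∧ LD Y W ∧ z = insert (m + 1) W := by
    intro z hz hzc hLz
    rcases h.cases hz with ⟨hzG, hzL⟩ | ⟨W, hW, hWR, rfl⟩
    · have e := eq_of_subset_of_card_le (subset_of_ld_insert_left (hG.sub z hzG) hLz) (by omega)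
      rw [e] at hzL
      exact absurd hzL hYb
    · rw [card_insert_succ (hG.sub W hW)] at hzc
      have e : #W = t := by omega
      exact ⟨W, hW, e, e ▸ hWR, (ld_insert_insert hYm (hG.sub W hW)).1 hLz, rfl⟩
  have hnotMem : ∀ x s, s ∈ Y → x < s → x ∉ Y → x ∉ insert (m + 1) Y := fun x s hs hxs hx => by
    have := lt_succ_of_mem hYm hs
    simp only [mem_insert, not_or]
    exact ⟨by omega, hx⟩
  by_cases hα : LD (B t) (Y.erase a)
  · refine ⟨a, mem_insert_of_mem ha, ?_, ?_, ?_⟩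
    · rw [herase a ha]
      exact h.right hSG hα
    · intro z hz hzc hLz
      obtain ⟨W, hW, hWt, hWR, hYW, rfl⟩ := hlow z hz (by omega) hLz
      rw [herase a ha, ld_insert_insert (hG.sub _ hSG) (hG.sub W hW)]
      exact hmin W hW (by omega) hYW
    · rcases halt with ⟨-, e⟩ | ⟨a₁, h1, h2, h3⟩
      · refine absurd ?_ hYb
        rw [e, card_icc_one]
        exact LD.icc_left (h.sub_B ht)
      · right
        have hc1 := card_insert_erase ha h2
        rcases h.total _ h3 with h' | h'
        · rw [hc1] at h'
          obtain ⟨x, hxS, hx1, hx2, hbx⟩ := LD.subset_of_between (S := Y.erase a) (a1 := a₁)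
            (a2 := a) (fun hh => h2 (mem_of_mem_erase hh)) (notMem_erase _ _) h1.ne h'
            (by rwa [insert_erase ha]) (by omega) (hG.wsep _ hSG _ hb)
          have hxa : x ≠ a := by
            rintro rfl
            rw [insert_erase ha] at hbx
            exact hYB hbx.symm
          refine ⟨x, by omega, hnotMem x a ha (by omega) (by grind), ?_⟩
          rw [herase a ha, insert_comm, ← hbx]
          exact h.right hb (by rw [hbc]; exact LD.refl _)
        · refine ⟨a₁, h1, hnotMem a₁ a ha h1 h2, ?_⟩
          rw [herase a ha, insert_comm]
          exact h.right h3 h'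
  · have hβ : LD (Y.erase a) (B t) := (h.total _ hSG).resolve_right hα
    have hcb : LD (B t) (B #Y) := h.B_le _ ht _ (by omega)
    have hsub := hβ.subset_of_erase (h.le_right hY hR (by omega)) hα hcc.le
    obtain ⟨s, hs, hcs⟩ := eq_erase_of_subset hsub (by omega)
    refine ⟨s, mem_insert_of_mem hs, ?_, ?_, Or.inr ?_⟩
    · rw [herase s hs, ← hcs]
      exact h.right hcG (by rw [hcc]; exact LD.refl _)
    · intro z hz hzc hLz
      obtain ⟨W, hW, hWt, hWR, hYW, rfl⟩ := hlow z hz (by omega) hLz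
      rwa [herase s hs, ← hcs, ld_insert_insert (hG.sub _ hcG) (hG.sub W hW)]
    · obtain ⟨x₀, hx, hxG, hxc, hxmin⟩ := h.exists_B_insert hP (k := t) (by omega)
      have hNb := hxmin _ hb (by omega) hcb
      have hYs : insert s (B t) = Y := by rw [hcs, insert_erase hs]
      have hsc : s ∉ B t := by
        rw [hcs]
        exact notMem_erase _ _
      obtain ⟨x, hxS, hx1, hx2, hbx⟩ := LD.subset_of_between (S := B t) (a1 := x₀) (a2 := s) hx hsc
        (by rintro rfl; rw [hYs] at hNb; exact hYb hNb) hNb (by rwa [hYs]) (by omega)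
        (hG.wsep _ hcG _ hb)
      have hxs : x ≠ s := by
        rintro rfl
        rw [hYs] at hbx
        exact hYB hbx.symm
      refine ⟨x, by omega, hnotMem x s hs (by omega) ?_, ?_⟩
      · rw [← hYs]
        simp only [mem_insert, not_or]
        exact ⟨hxs, hxS⟩
      · rw [herase s hs, insert_comm, ← hcs, ← hbx]
        exact h.right hb (by rw [hbc]; exact LD.refl _)

lemma hasDescend (hJ : ∀ F, MaxW (m + 1) F → ∀ X₁ ∈ F, ∀ X₂ ∈ F, HasJoin F X₁ X₂)
    (h : Exp m F G B) {U : Finset ℕ} (hU : U ∈ F) (hne : U.Nonempty)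
    (hS : ∀ Z ∈ F, ¬ Sur U Z) : HasDescend F U := by
  rcases h.cases hU with ⟨hX, hL⟩ | ⟨Y, hY, hR, rfl⟩
  · exact h.hasDescend_left hP hJ hX hL hne hS
  · exact h.hasDescend_right hP hY hR hS

end Exp

lemma erase_insert_succ {m s : ℕ} {Y : Finset ℕ} (hY : Y ⊆ Icc 1 m) (hs : s ∈ Y) :
    (insert (m + 1) Y).erase s = insert (m + 1) (Y.erase s) := by
  have := lt_succ_of_mem hY hs
  exact erase_insert_of_ne (by omega)

namespace Exp
variable {m : ℕ} {F G : Finset (Finset ℕ)} {B : ℕ → Finset ℕ}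

lemma sur_insert_of_not_ld (h : Exp m F G B) {U Y : Finset ℕ} (hU : U ∈ G) (hL : LD U (B #U))
    (hY : Y ∈ G) (hR : LD (B #Y) Y) (hc : #U = #Y + 1) (hn : ¬ LD U Y) :
    Sur U (insert (m + 1) Y) := by
  have hUm := h.maxG.sub _ hU
  have hYm := h.maxG.sub _ hY
  rcases (h.maxF.wsep _ (h.left hU hL) _ (h.right hY hR)).cases_of_card_eq
    (by rw [card_insert_succ hYm, hc]) with h' | h' | h' | h'
  · exact absurd ((ld_insert_right hUm).1 h') hn
  · have := card_le_card (subset_of_ld_insert_left hUm h')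
    omega
  · exact h'
  · exact absurd ((cv_insert_left hUm).1 h'.2.1) hn

/-- A right member obstructing `U − {a}` without obstructing it in `G` lies one size below `U`. -/
lemma not_ld_erase_of_not_wsep (h : Exp m F G B) {U Y : Finset ℕ} {a : ℕ} (hU : U ∈ G)
    (hL : LD U (B #U)) (ha : a ∈ U) (hY : Y ∈ G) (hR : LD (B #Y) Y) (hs : WSep (U.erase a) Y)
    (hV : ¬ WSep (insert (m + 1) Y) (U.erase a)) : #U = #Y + 1 ∧ ¬ LD (U.erase a) Y := by
  have hSm := (erase_subset a U).trans (h.maxG.sub _ hU)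
  have hc := card_erase_add_one ha
  rw [wsep_comm, wsep_insert_right hSm (h.maxG.sub _ hY)] at hV
  have hV' : #(U.erase a) ≤ #Y ∧ ¬ LD (U.erase a) Y := by tauto
  refine ⟨?_, hV'.2⟩
  by_contra hne
  have hUY := h.left_right hU hL hY hR (by omega)
  exact hV'.2 (LD.trans_of_le (LD.of_subset (erase_subset a U)) hUY hs (by omega) (by omega))

variable (hP : ∀ G, MaxW m G → Good m G)
include hP

lemma hasExchange_left (h : Exp m F G B) {U Z : Finset ℕ} (hU : U ∈ G) (hL : LD U (B #U))
    (hZ : Z ∈ G) (hS : Sur U Z) : HasExchange F U := by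
  have hG := h.maxG
  have hk := hG.card_le hU
  have hb := h.B_mem _ hk
  have hbc := h.B_card _ hk
  have hUm := hG.sub _ hU
  obtain ⟨a, ha, a₁, a₂, h1, h2, h1a, ha2, hm1, hm2, hobs⟩ := (hP G hG).exchange U hU Z hZ hS
  have hc := card_erase_add_one ha
  have hc1 := card_insert_erase ha h1
  have hc2 := card_insert_erase ha h2
  have hL1 : LD (insert a₁ (U.erase a)) (B #(insert a₁ (U.erase a))) := by
    rw [hc1]
    exact hG.trans_le hm1 hb (ld_insert_erase_left h1a) hL hc1.le hbc.ge
  have hF1 := h.left hm1 hL1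
  obtain ⟨x, hxU, hax, hxF⟩ : ∃ x, x ∉ U ∧ a < x ∧ insert x (U.erase a) ∈ F := by
    rcases h.total _ hm2 with h' | h'
    · exact ⟨a₂, h2, ha2, h.left hm2 h'⟩
    · rw [hc2] at h'
      have hsb : WSep (U.erase a) (B #U) := by
        by_contra hcon
        exact (hobs _ hb fun hh => hcon hh.symm).2.2.1 hL
      obtain ⟨x, hxS, hx1, hx2, hbx⟩ := LD.subset_of_between (S := U.erase a) (a1 := a) (a2 := a₂)
        (notMem_erase _ _) (fun hh => h2 (mem_of_mem_erase hh)) ha2.ne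
        (by rwa [insert_erase ha]) h' (by omega) hsb
      have hxa : x ≠ a := by
        rintro rfl
        rw [insert_erase ha] at hbx
        have htot := h.total Z hZ
        rw [← hS.1, hbx] at htot
        exact htot.elim hS.2.2.2 hS.2.2.1
      refine ⟨x, fun hx => hxS (mem_erase.2 ⟨hxa, hx⟩), by omega, ?_⟩
      rw [← hbx]
      exact h.left hb (by rw [hbc]; exact LD.refl _)
  refine ⟨a, ha, a₁, x, h1, hxU, h1a, hax, hF1, hxF, fun V hV hVS => ?_⟩
  rcases h.cases hV with ⟨hVG, -⟩ | ⟨Y, hY, hR, rfl⟩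
  · exact hobs V hVG hVS
  have hYm := hG.sub _ hY
  have hsY : WSep (U.erase a) Y := by
    by_contra hcon
    have hsur := hobs Y hY fun hh => hcon hh.symm
    exact hsur.2.2.1 (h.left_right hU hL hY hR hsur.1.le)
  obtain ⟨hcY, hn⟩ := h.not_ld_erase_of_not_wsep hU hL ha hY hR hsY hVS
  refine h.sur_insert_of_not_ld hU hL hY hR hcY fun hUY => hn fun p hp hpY q hq hqS => ?_
  by_contra hpq
  have hpU := mem_of_mem_erase hp
  have hqU : q ∈ U := by
    by_contra hqU
    exact hpq (hUY p hpU hpY q hq hqU)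
  have hqa : q = a := by
    by_contra hqa
    exact hqS (mem_erase.2 ⟨hqa, hqU⟩)
  subst hqa
  have hpq' : q < p := by
    have : p ≠ q := fun e => hpY (e ▸ hq)
    omega
  have hpm := lt_succ_of_mem hUm hpU
  have ha1Y : a₁ ∉ Y := fun hh => by
    have := hUY p hpU hpY a₁ hh h1
    omega
  have hpn : p ∉ insert (m + 1) Y := by
    simp only [mem_insert, not_or]
    exact ⟨by omega, hpY⟩
  have ha1n : a₁ ∉ insert (m + 1) Y := by
    simp only [mem_insert, not_or]
    exact ⟨by omega, ha1Y⟩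
  have hql : q ∉ insert a₁ (U.erase q) := by
    simp only [mem_insert, not_or]
    exact ⟨by omega, notMem_erase _ _⟩
  rcases h.maxF.wsep _ hF1 _ (h.right hY hR) with hh | hh
  · exact hh.2 a₁ (mem_insert_self _ _) ha1n p (mem_insert_of_mem hp) hpn q (mem_insert_of_mem hq)
      hql ⟨h1a, hpq'⟩
  · exact hh.2 q (mem_insert_of_mem hq) hql (m + 1) (mem_insert_self _ _)
      (succ_notMem (hG.sub _ hm1)) p (mem_insert_of_mem hp) hpn ⟨hpq', hpm⟩

lemma hasExchange_left_right (h : Exp m F G B) {U Y : Finset ℕ} (hU : U ∈ G) (hL : LD U (B #U))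
    (hY : Y ∈ G) (hR : LD (B #Y) Y) (hS : Sur U (insert (m + 1) Y))
    (hSG : ∀ Z ∈ G, ¬ Sur U Z) : HasExchange F U := by
  have hG := h.maxG
  have hk := hG.card_le hU
  have hUm := hG.sub _ hU
  have hYm := hG.sub _ hY
  have hcUY := hS.1
  rw [card_insert_succ hYm] at hcUY
  have hUY : ¬ LD U Y := fun hh => hS.2.2.1 ((ld_insert_right hUm).2 hh)
  obtain ⟨a, ha, hSm, hmin, halt⟩ := (hP G hG).descend U hU (card_pos.1 (by omega)) hSG
  have hc := card_erase_add_one ha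
  have hcm := h.B_mem #Y (by omega)
  have hcc := h.B_card #Y (by omega)
  have hUc : ¬ LD U (B #Y) := fun hh => hUY (hG.trans_ge hU hY hh hR (by omega) (by omega))
  have hcS : LD (B #(U.erase a)) (U.erase a) := by
    refine (h.total _ hSm).resolve_left fun hh => hUc ?_
    rw [show #(U.erase a) = #Y by omega] at hh
    exact hG.trans_ge hU hcm (LD.of_superset (erase_subset a U)) hh (by omega) (by omega)
  obtain ⟨a₁, h1a, h1, hm1⟩ := halt.resolve_left fun hh => hUc (by
    rw [hh.2]
    exact LD.icc_left (hG.sub _ hcm))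
  have hc1 := card_insert_erase ha h1
  refine ⟨a, ha, a₁, m + 1, h1, succ_notMem hUm, h1a, lt_succ_of_mem hUm ha, h.left hm1 ?_,
    h.right hSm hcS, fun V hV hVS => ?_⟩
  · rw [hc1]
    exact hG.trans_le hm1 (h.B_mem _ hk) (ld_insert_erase_left h1a) hL hc1.le (h.B_card _ hk).ge
  · rcases h.cases hV with ⟨hVG, -⟩ | ⟨W, hW, hWR, rfl⟩
    · exact absurd (hG.wsep _ hVG _ hSm) hVS
    · obtain ⟨hcW, hn⟩ := h.not_ld_erase_of_not_wsep hU hL ha hW hWR (hG.wsep _ hSm _ hW) hVS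
      exact h.sur_insert_of_not_ld hU hL hW hWR hcW fun hUW => hn (hmin W hW hcW.symm hUW)

lemma hasExchange_right (h : Exp m F G B) {U Z : Finset ℕ} (hU : U ∈ G) (hR : LD (B #U) U)
    (hZ : Z ∈ G) (hS : Sur U Z) : HasExchange F (insert (m + 1) U) := by
  have hG := h.maxG
  have hk := hG.card_le hU
  have hb := h.B_mem _ hk
  have hbc := h.B_card _ hk
  have hUm := hG.sub _ hU
  obtain ⟨a, ha, a₁, a₂, h1, h2, h1a, ha2, hm1, hm2, hobs⟩ := (hP G hG).exchange U hU Z hZ hS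
  have hc := card_erase_add_one ha
  have hc1 := card_insert_erase ha h1
  have hc2 := card_insert_erase ha h2
  have ham := lt_succ_of_mem hUm ha
  have hR2 : LD (B #(insert a₂ (U.erase a))) (insert a₂ (U.erase a)) := by
    rw [hc2]
    exact hG.trans_le hb hm2 hR (ld_insert_erase_right ha2) hbc.le hc2.ge
  have hF2 := h.right hm2 hR2
  have ha2m := lt_succ_of_mem (hG.sub _ hm2) (mem_insert_self _ _)
  obtain ⟨x, hxU, hxa, hxF⟩ :
      ∃ x, x ∉ U ∧ x < a ∧ insert (m + 1) (insert x (U.erase a)) ∈ F := by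
    rcases h.total _ hm1 with h' | h'
    · rw [hc1] at h'
      have hsb : WSep (U.erase a) (B #U) := by
        by_contra hcon
        exact (hobs _ hb fun hh => hcon hh.symm).2.2.2 hR
      obtain ⟨x, hxS, hx1, hx2, hbx⟩ := LD.subset_of_between (S := U.erase a) (a1 := a₁) (a2 := a)
        (fun hh => h1 (mem_of_mem_erase hh)) (notMem_erase _ _) h1a.ne
        h' (by rwa [insert_erase ha]) (by omega) hsb
      have hxa : x ≠ a := by
        rintro rfl
        rw [insert_erase ha] at hbx
        have htot := h.total Z hZ
        rw [← hS.1, hbx] at htot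
        exact htot.elim hS.2.2.2 hS.2.2.1
      refine ⟨x, fun hx => hxS (mem_erase.2 ⟨hxa, hx⟩), by omega, ?_⟩
      rw [← hbx]
      exact h.right hb (by rw [hbc]; exact LD.refl _)
    · exact ⟨a₁, h1, h1a, h.right hm1 h'⟩
  unfold HasExchange
  refine ⟨a, mem_insert_of_mem ha, x, a₂, ?_, ?_, hxa, ha2, ?_, ?_, fun V hV hVS => ?_⟩
  · simp only [mem_insert, not_or]
    exact ⟨by omega, hxU⟩
  · simp only [mem_insert, not_or]
    exact ⟨by omega, h2⟩
  · rwa [erase_insert_succ hUm ha, insert_comm]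
  · rwa [erase_insert_succ hUm ha, insert_comm]
  rw [erase_insert_succ hUm ha] at hVS
  have hSm := (erase_subset a U).trans hUm
  rcases h.cases hV with ⟨hX, hXL⟩ | ⟨W, hW, -, rfl⟩
  · have hXS : WSep V (U.erase a) := by
      by_contra hcon
      have hsur := hobs V hX hcon
      exact hsur.2.2.2 (h.left_right hX hXL hU hR hsur.1.ge)
    rw [wsep_insert_right (hG.sub _ hX) hSm] at hVS
    have hVS' : #V ≤ #(U.erase a) ∧ ¬ LD V (U.erase a) := by tauto
    have hcm := h.B_mem #(U.erase a) (by omega)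
    have hcc := h.B_card #(U.erase a) (by omega)
    have hcU := h.le_right hU hR (k := #(U.erase a)) (by omega)
    rcases LD.ld_or_subset_of_insert (notMem_erase a U) (fun hh => h2 (mem_of_mem_erase hh)) ha2
      hcc (by rwa [insert_erase ha]) (hG.wsep _ hcm _ hm2) with hh | hh
    · exact absurd (LD.trans_of_le (h.left_le hX hXL hVS'.1 (by omega)) hh hXS (by omega) hcc.le)
        hVS'.2
    · rw [insert_erase ha] at hh
      exact absurd (hG.wsep _ hcm _ hZ) (hS.not_wsep_of_subset hh (by omega))
  · rw [wsep_insert_insert (hG.sub _ hW) hSm] at hVS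
    exact (sur_insert_insert hUm (hG.sub _ hW)).2 (hobs W hW hVS)

lemma hasExchange (h : Exp m F G B) {U Z : Finset ℕ} (hU : U ∈ F) (hZ : Z ∈ F) (hS : Sur U Z) :
    HasExchange F U := by
  have hG := h.maxG
  rcases h.cases hU with ⟨hX, hL⟩ | ⟨Y, hY, hR, rfl⟩
  · by_cases hSG : ∃ W ∈ G, Sur U W
    · obtain ⟨W, hW, hUW⟩ := hSG
      exact h.hasExchange_left hP hX hL hW hUW
    · push Not at hSG
      rcases h.cases hZ with ⟨hZG, -⟩ | ⟨Y, hY, hR, rfl⟩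
      · exact absurd hS (hSG Z hZG)
      · exact h.hasExchange_left_right hP hX hL hY hR hS hSG
  · rcases h.cases hZ with ⟨hZG, -⟩ | ⟨W, hW, -, rfl⟩
    · have hZm := hG.sub _ hZG
      exact absurd ((ld_insert_right hZm).2 ((cv_insert_left hZm).1 hS.2.1)) hS.2.2.2
    · exact h.hasExchange_right hP hY hR hW ((sur_insert_insert (hG.sub _ hY) (hG.sub _ hW)).1 hS)

end Exp

/-- Every maximal weakly separated collection in `2^[m]` is good. -/
theorem MaxW.good {m : ℕ} {G : Finset (Finset ℕ)} (h : MaxW m G) : Good m G := by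
  induction m generalizing G with
  | zero =>
    have hsub : ∀ X ∈ G, X = ∅ := fun X hX => by simpa using h.sub X hX
    have hG : G = {∅} := by
      refine eq_singleton_iff_unique_mem.2 ⟨?_, hsub⟩
      simpa using h.icc_left_mem (le_refl 0)
    subst hG
    refine ⟨?_, ?_, ?_, by simp⟩
    · intro X₁ h₁ X₂ h₂
      rw [hsub X₁ h₁, hsub X₂ h₂]
      exact ⟨∅, mem_singleton_self _, ⟨le_rfl, LD.refl _⟩, ⟨le_rfl, LD.refl _⟩, fun _ _ h _ => h⟩
    · intro U hU hne
      exact absurd (hsub U hU) hne.ne_empty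
    · intro U hU Z hZ hS
      rw [hsub U hU, hsub Z hZ] at hS
      exact absurd (LD.refl _) hS.2.2.1
  | succ m ih =>
    have hP : ∀ G, MaxW m G → Good m G := fun G hG => ih hG
    have hJ : ∀ F, MaxW (m + 1) F → ∀ X₁ ∈ F, ∀ X₂ ∈ F, HasJoin F X₁ X₂ := by
      intro F hF X₁ h₁ X₂ h₂
      obtain ⟨G, B, hE⟩ := exists_exp hP hF
      exact hE.hasJoin hP h₁ h₂
    obtain ⟨G', B, hE⟩ := exists_exp hP h
    refine ⟨hJ _ h, fun U hU => hE.hasDescend hP hJ hU,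
      fun U hU Z hZ => hE.hasExchange hP hU hZ, ?_⟩
    have h1 := hE.card_eq
    have h2 := (hP G' hE.maxG).card_eq
    rw [h1, mul_add, h2]
    ring

lemma setLT_iff {A B : Finset ℕ} (hB : B.Nonempty) (h0 : 0 ∉ B) :
    SetLT A B ↔ ∀ a ∈ A, ∀ b ∈ B, a < b := by
  unfold SetLT max0 min0
  rw [dif_pos hB]
  split_ifs with hA
  · constructor
    · intro h a ha b hb
      exact (A.le_max' a ha).trans_lt (h.trans_le (B.min'_le b hb))
    · exact fun h => h _ (A.max'_mem hA) _ (B.min'_mem hB)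
  · rw [not_nonempty_iff_eq_empty.1 hA]
    have := B.min'_mem hB
    simpa using Nat.pos_of_ne_zero fun h => h0 (h ▸ this)

lemma lessDot_iff {A B : Finset ℕ} (h0 : 0 ∉ B) (hne : (B \ A).Nonempty) :
    LessDot A B ↔ LD A B := by
  unfold LessDot LD
  rw [setLT_iff hne (by simp [h0])]
  simp only [mem_sdiff, and_imp]

lemma LessDot.ld {A B : Finset ℕ} (h0 : 0 ∉ B) (h : LessDot A B) : LD A B := by
  by_cases hne : (B \ A).Nonempty
  · exact (lessDot_iff h0 hne).1 h
  · exact LD.of_superset (sdiff_eq_empty_iff_subset.1 (not_nonempty_iff_eq_empty.1 hne))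

lemma Splits.cv {A B : Finset ℕ} (hA : 0 ∉ A) (hB : 0 ∉ B) (h : Splits A B) : Cv A B := by
  obtain ⟨hne, B', B'', h', h'', hU, h1, h2⟩ := h
  have hB'' : 0 ∉ B'' := fun hh => by
    have : 0 ∈ B \ A := hU ▸ mem_union_right _ hh
    exact hB (mem_sdiff.1 this).1
  rw [setLT_iff hne (by simp [hA])] at h1
  rw [setLT_iff h'' hB''] at h2
  intro a ha haB a' ha' haB' b hb hbA
  have hbU : b ∈ B' ∪ B'' := hU ▸ mem_sdiff.2 ⟨hb, hbA⟩
  rcases mem_union.1 hbU with hh | hh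
  · have := h1 b hh a (mem_sdiff.2 ⟨ha, haB⟩)
    omega
  · have := h2 a' (mem_sdiff.2 ⟨ha', haB'⟩) b hh
    omega

lemma weaklySep_of_cv {A B : Finset ℕ} (hA : 0 ∉ A) (hB : 0 ∉ B) (hc : #B ≤ #A) (h : Cv A B) :
    WeaklySep A B := by
  by_cases hAB : A ⊆ B
  · exact Or.inl (Or.inr (Or.inr (eq_of_subset_of_card_le hAB hc)))
  have hne : (A \ B).Nonempty := sdiff_nonempty.2 hAB
  have hmin := (A \ B).min'_mem hne
  set s := (A \ B).min' hne
  have hs := mem_sdiff.1 hmin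
  have hsle : ∀ a ∈ A, a ∉ B → s ≤ a := fun a ha haB => (A \ B).min'_le a (mem_sdiff.2 ⟨ha, haB⟩)
  by_cases h2 : ((B \ A).filter (s < ·)).Nonempty
  · by_cases h1 : ((B \ A).filter (· < s)).Nonempty
    · refine Or.inr (Or.inl ⟨⟨hne, _, _, h1, h2, ?_, ?_, ?_⟩, hc⟩)
      · rw [← filter_or, filter_true_of_mem]
        intro b hb
        have : b ≠ s := fun e => (mem_sdiff.1 hb).2 (e ▸ hs.1)
        omega
      · rw [setLT_iff hne (by simp [hA])]
        intro b hb a ha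
        have := hsle a (mem_sdiff.1 ha).1 (mem_sdiff.1 ha).2
        have := (mem_filter.1 hb).2
        omega
      · rw [setLT_iff h2 (by simp [hB])]
        intro a ha b hb
        have hb' := mem_filter.1 hb
        have hb'' := mem_sdiff.1 hb'.1
        have ha' := mem_sdiff.1 ha
        have hab : a ≠ b := fun e => hb''.2 (e ▸ ha'.1)
        have := h s hs.1 hs.2 a ha'.1 ha'.2 b hb''.1 hb''.2
        omega
    · refine Or.inl (Or.inl ((lessDot_iff hB (h2.mono (filter_subset _ _))).2 ?_))
      intro a ha haB b hb hbA
      have hbs : ¬ b < s := fun hh => h1 ⟨b, mem_filter.2 ⟨mem_sdiff.2 ⟨hb, hbA⟩, hh⟩⟩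
      have hbs' : b ≠ s := fun e => hbA (e ▸ hs.1)
      have hab : a ≠ b := fun e => hbA (e ▸ ha)
      have := h s hs.1 hs.2 a ha haB b hb hbA
      omega
  · refine Or.inl (Or.inr (Or.inl ((lessDot_iff hA hne).2 ?_)))
    intro b hb hbA a ha haB
    have hbs : ¬ s < b := fun hh => h2 ⟨b, mem_filter.2 ⟨mem_sdiff.2 ⟨hb, hbA⟩, hh⟩⟩
    have hbs' : b ≠ s := fun e => hbA (e ▸ hs.1)
    have := hsle a ha haB
    omega

lemma WeaklySep.symm {A B : Finset ℕ} (h : WeaklySep A B) : WeaklySep B A := by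
  unfold WeaklySep StronglySep at *
  have := eq_comm (a := A) (b := B)
  tauto

theorem weaklySep_iff {A B : Finset ℕ} (hA : 0 ∉ A) (hB : 0 ∉ B) :
    WeaklySep A B ↔ WSep A B := by
  constructor
  · rintro ((h | h | rfl) | ⟨h, hc⟩ | ⟨h, hc⟩)
    · exact (h.ld hB).wsep
    · exact (h.ld hA).wsep'
    · exact WSep.refl _
    · exact Or.inl ⟨hc, h.cv hA hB⟩
    · exact Or.inr ⟨hc, h.cv hB hA⟩
  · rintro (⟨hc, h⟩ | ⟨hc, h⟩)
    · exact weaklySep_of_cv hA hB hc h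
    · exact (weaklySep_of_cv hB hA hc h).symm

/-- The sets `Y` with `j ∈ Y` whenever `i < j`, `ω(i) > ω(j)` and `i ∈ Y`. -/
def OppDomain (n : ℕ) (ω : ℕ → ℕ) : Set (Finset ℕ) :=
  {Y | Y ⊆ Icc 1 n ∧ ∀ i ∈ Icc 1 n, ∀ j ∈ Icc 1 n, i < j → ω j < ω i → i ∈ Y → j ∈ Y}

/-- The elements of `[n]` with `ω`-value at most `k`. -/
def lowerSet (n : ℕ) (ω : ℕ → ℕ) (k : ℕ) : Finset ℕ := (Icc 1 n).filter fun i => ω i ≤ k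

/-- The permutation `i ↦ n + 1 − ω(i)`. -/
def revPerm (n : ℕ) (ω : ℕ → ℕ) (i : ℕ) : ℕ := n + 1 - ω i

section Domains
variable {n : ℕ} {ω : ℕ → ℕ}

lemma mem_lowerSet {k i : ℕ} : i ∈ lowerSet n ω k ↔ i ∈ Icc 1 n ∧ ω i ≤ k := mem_filter

lemma lowerSet_subset (k : ℕ) : lowerSet n ω k ⊆ Icc 1 n := filter_subset _ _

lemma lowerSet_mono {k l : ℕ} (h : k ≤ l) : lowerSet n ω k ⊆ lowerSet n ω l :=
  monotone_filter_right _ fun _ _ hi => le_trans hi h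

lemma lowerSet_mem_opp (k : ℕ) : lowerSet n ω k ∈ OppDomain n ω :=
  ⟨lowerSet_subset k, fun _ _ _ hj _ hlt hi =>
    mem_lowerSet.2 ⟨hj, hlt.le.trans (mem_lowerSet.1 hi).2⟩⟩

lemma lowerSet_union_mem (k t : ℕ) (ht : t ≤ n) :
    lowerSet n ω k ∪ Icc 1 t ∈ ChamberDomain n ω := by
  refine ⟨union_subset (lowerSet_subset k) (Icc_subset_Icc_right ht), fun i hi j _ hij hlt hm => ?_⟩
  rcases mem_union.1 hm with h | h
  · exact mem_union_left _ (mem_lowerSet.2 ⟨hi, hlt.le.trans (mem_lowerSet.1 h).2⟩)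
  · rw [mem_Icc] at h hi
    exact mem_union_right _ (mem_Icc.2 (by omega))

lemma lowerSet_mem (k : ℕ) : lowerSet n ω k ∈ ChamberDomain n ω := by
  simpa using lowerSet_union_mem (ω := ω) k 0 (Nat.zero_le n)

lemma zero_notMem_of_subset {X : Finset ℕ} (h : X ⊆ Icc 1 n) : 0 ∉ X := fun hh => by
  simpa using h hh

lemma ld_lowerSet_union {k l s t : ℕ} (hk : k ≤ l) (hs : t ≤ s) :
    LD (lowerSet n ω k ∪ Icc 1 s) (lowerSet n ω l ∪ Icc 1 t) := by
  intro a ha haB b hb hbA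
  simp only [mem_union, not_or, mem_Icc] at ha haB hb hbA
  have e1 : a ∉ lowerSet n ω k := fun h => haB.1 (lowerSet_mono hk h)
  have e2 : b ∈ lowerSet n ω l := hb.resolve_right (by omega)
  have e3 := mem_Icc.1 (lowerSet_subset l e2)
  have e4 := ha.resolve_left e1
  omega

lemma wsep_lowerSet_union (k l s t : ℕ) :
    WSep (lowerSet n ω k ∪ Icc 1 s) (lowerSet n ω l ∪ Icc 1 t) := by
  rcases le_total k l with hk | hk <;> rcases le_total s t with hs | hs
  · exact (LD.of_subset (union_subset_union (lowerSet_mono hk) (Icc_subset_Icc_right hs))).wsep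
  · exact (ld_lowerSet_union hk hs).wsep
  · exact (ld_lowerSet_union hk hs).wsep'
  · exact (LD.of_subset (union_subset_union (lowerSet_mono hk) (Icc_subset_Icc_right hs))).wsep'

lemma cpl_mem_opp (hω : Set.BijOn ω (Set.Icc 1 n) (Set.Icc 1 n)) {X : Finset ℕ}
    (hX : X ∈ ChamberDomain n (revPerm n ω)) : cpl n X ∈ OppDomain n ω := by
  refine ⟨cpl_subset n X, fun i hi j hj hij hlt hm => ?_⟩
  rw [mem_cpl] at hm ⊢
  have h1 : ω i ≤ n := (hω.mapsTo (by simpa using hi)).2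
  exact ⟨mem_Icc.1 hj, fun hjX => hm.2 (hX.2 i hi j hj hij (by unfold revPerm; omega) hjX)⟩

lemma bijOn_revPerm (hω : Set.BijOn ω (Set.Icc 1 n) (Set.Icc 1 n)) :
    Set.BijOn (revPerm n ω) (Set.Icc 1 n) (Set.Icc 1 n) := by
  have hm : ∀ i ∈ Set.Icc 1 n, 1 ≤ ω i ∧ ω i ≤ n := fun i hi => hω.mapsTo hi
  refine ⟨fun i hi => ?_, fun i hi j hj hij => hω.injOn hi hj ?_, fun y hy => ?_⟩
  · have := hm i hi
    simp only [revPerm, Set.mem_Icc]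
    omega
  · have := hm i hi
    have := hm j hj
    simp only [revPerm] at hij
    omega
  · obtain ⟨x, hx, hxy⟩ := hω.surjOn (show n + 1 - y ∈ Set.Icc 1 n by
      simp only [Set.mem_Icc] at hy ⊢; omega)
    refine ⟨x, hx, ?_⟩
    simp only [revPerm, Set.mem_Icc] at hy ⊢
    omega

lemma card_invPairs_add (hω : Set.BijOn ω (Set.Icc 1 n) (Set.Icc 1 n)) :
    2 * (#(InvPairs n ω) + #(InvPairs n (revPerm n ω))) + n = n * n := by
  set T := (Icc 1 n ×ˢ Icc 1 n).filter fun p : ℕ × ℕ => p.1 < p.2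
  have hm : ∀ i ∈ Icc 1 n, 1 ≤ ω i ∧ ω i ≤ n := fun i hi => hω.mapsTo (by simpa using hi)
  have h1 : InvPairs n ω = T.filter fun p => ω p.2 < ω p.1 := by
    simp only [InvPairs, T, filter_filter]
  have h2 : InvPairs n (revPerm n ω) = T.filter fun p => ¬ ω p.2 < ω p.1 := by
    simp only [InvPairs, T, filter_filter]
    refine filter_congr fun p hp => and_congr_right fun hlt => ?_
    obtain ⟨hp1, hp2⟩ := mem_product.1 hp
    have e1 := hm _ hp1
    have e2 := hm _ hp2
    have e3 : ω p.1 ≠ ω p.2 := fun e =>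
      hlt.ne (hω.injOn (by simpa using hp1) (by simpa using hp2) e)
    simp only [revPerm]
    omega
  rw [h1, h2, card_filter_add_card_filter_not]
  have h3 : #((Icc 1 n).offDiag) = #T + #T := by
    have : (Icc 1 n).offDiag = T ∪ T.image Prod.swap := by
      ext ⟨i, j⟩
      simp only [mem_offDiag, mem_union, mem_image, T, mem_filter, mem_product, Prod.exists,
        Prod.swap_prod_mk, Prod.mk.injEq]
      constructor
      · rintro ⟨hi, hj, hne⟩
        rcases lt_or_gt_of_ne hne with h | h
        · exact Or.inl ⟨⟨hi, hj⟩, h⟩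
        · exact Or.inr ⟨j, i, ⟨⟨hj, hi⟩, h⟩, rfl, rfl⟩
      · rintro (⟨⟨hi, hj⟩, h⟩ | ⟨_, _, ⟨⟨hi, hj⟩, h⟩, rfl, rfl⟩)
        · exact ⟨hi, hj, h.ne⟩
        · exact ⟨hj, hi, h.ne'⟩
    rw [this, card_union_of_disjoint, card_image_of_injective _ Prod.swap_injective]
    rw [disjoint_left]
    rintro ⟨i, j⟩ h h'
    simp only [mem_image, T, mem_filter, Prod.exists, Prod.swap_prod_mk, Prod.mk.injEq] at h h'
    obtain ⟨_, _, ⟨_, h'⟩, rfl, rfl⟩ := h'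
    omega
  rw [offDiag_card, Nat.card_Icc] at h3
  have : n ≤ n * n := Nat.le_mul_self n
  simp only [Nat.add_sub_cancel] at h3
  omega

lemma ld_of_mem_opp (hω : Set.BijOn ω (Set.Icc 1 n) (Set.Icc 1 n)) {X Y : Finset ℕ}
    (hX : X ∈ ChamberDomain n ω) (hY : Y ∈ OppDomain n ω) : LD X Y := by
  intro a ha haY b hb hbX
  by_contra hab
  have ha' := hX.1 ha
  have hb' := hY.1 hb
  have hne : a ≠ b := fun e => hbX (e ▸ ha)
  have hωne : ω b ≠ ω a := fun e => hne (hω.injOn (by simpa using ha') (by simpa using hb') e.symm)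
  rcases lt_or_gt_of_ne hωne with h | h
  · exact hbX (hX.2 b hb' a ha' (by omega) h ha)
  · exact haY (hY.2 b hb' a ha' (by omega) h hb)

lemma card_lowerSet (hω : Set.BijOn ω (Set.Icc 1 n) (Set.Icc 1 n)) {k : ℕ} (hk : k ≤ n) :
    #(lowerSet n ω k) = k := by
  have : (lowerSet n ω k).image ω = Icc 1 k := by
    ext y
    simp only [mem_image, mem_lowerSet, mem_Icc]
    constructor
    · rintro ⟨i, ⟨hi, hik⟩, rfl⟩
      exact ⟨(hω.mapsTo hi).1, hik⟩
    · rintro ⟨h1, h2⟩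
      obtain ⟨i, hi, rfl⟩ := hω.surjOn (show y ∈ Set.Icc 1 n from ⟨h1, h2.trans hk⟩)
      exact ⟨i, ⟨hi, h2⟩, rfl⟩
  have hinj : Set.InjOn ω (lowerSet n ω k) := fun i hi j hj e =>
    hω.injOn (by simpa using lowerSet_subset k hi) (by simpa using lowerSet_subset k hj) e
  rw [← card_image_of_injOn hinj, this, card_icc_one]

lemma exists_eq_lowerSet (hω : Set.BijOn ω (Set.Icc 1 n) (Set.Icc 1 n)) {Z : Finset ℕ}
    (h1 : Z ∈ ChamberDomain n ω) (h2 : Z ∈ OppDomain n ω) : ∃ k ≤ n, Z = lowerSet n ω k := by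
  have hm : ∀ i ∈ Icc 1 n, 1 ≤ ω i ∧ ω i ≤ n := fun i hi => hω.mapsTo (by simpa using hi)
  rcases Z.eq_empty_or_nonempty with rfl | hne
  · refine ⟨0, Nat.zero_le n, (filter_false_of_mem fun i hi => ?_).symm⟩
    have := hm i hi
    omega
  obtain ⟨j, hj, hmax⟩ := Z.exists_max_image ω hne
  have hjn := h1.1 hj
  refine ⟨ω j, (hm j hjn).2, ?_⟩
  ext i
  rw [mem_lowerSet]
  refine ⟨fun hi => ⟨h1.1 hi, hmax i hi⟩, fun ⟨hi, hle⟩ => ?_⟩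
  rcases hle.eq_or_lt with e | hlt
  · rwa [hω.injOn (by simpa using hi) (by simpa using hjn) e]
  · rcases lt_trichotomy i j with h | rfl | h
    · exact h1.2 i hi j hjn h hlt hj
    · exact hj
    · exact h2.2 j hjn i hi h hlt hj

lemma ld_or_ld_lowerSet (hω : Set.BijOn ω (Set.Icc 1 n) (Set.Icc 1 n)) {Z : Finset ℕ}
    (hZ : Z ⊆ Icc 1 n) (h : ∀ k ≤ n, WSep Z (lowerSet n ω k)) {k : ℕ} (hk : k ≤ n) :
    LD Z (lowerSet n ω k) ∨ LD (lowerSet n ω k) Z := by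
  by_contra! hcon
  obtain ⟨h1, h2⟩ := hcon
  unfold LD at h1 h2
  push Not at h1 h2
  obtain ⟨a, ha, haI, b, hb, hbZ, hab⟩ := h1
  obtain ⟨c, hc, hcZ, d, hd, hdI, hcd⟩ := h2
  have hab' : a ≠ b := fun e => haI (e ▸ hb)
  have hcd' : c ≠ d := fun e => hcZ (e ▸ hd)
  have hck := card_lowerSet hω hk
  rcases h k hk with ⟨hcard, hv⟩ | ⟨hcard, hv⟩
  · have hac := hv d hd hdI a ha haI c hc hcZ
    have hac' : a ≠ c := fun e => hcZ (e ▸ ha)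
    have hbc : b < c := by omega
    have hsub : insert b (insert c Z) ⊆ Icc 1 n :=
      insert_subset (lowerSet_subset k hb) (insert_subset (lowerSet_subset k hc) hZ)
    have hcins : #(insert b (insert c Z)) = #Z + 2 := by
      rw [card_insert_of_notMem, card_insert_of_notMem hcZ]
      simp only [mem_insert, not_or]
      exact ⟨hbc.ne, hbZ⟩
    have hn := card_le_card hsub
    rw [card_icc_one] at hn
    have hle : #Z + 1 ≤ n := by omega
    have hc1 := card_lowerSet hω hle
    have hmono := lowerSet_mono (n := n) (ω := ω) (show k ≤ #Z + 1 by omega)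
    obtain ⟨t, ht, htI⟩ : ∃ t ∈ Z, t ∉ lowerSet n ω (#Z + 1) := by
      by_contra! hcon
      have := card_le_card (insert_subset (hmono hb) (insert_subset (hmono hc) hcon))
      omega
    have htI' : t ∉ lowerSet n ω k := fun hh => htI (hmono hh)
    have e1 := hv t ht htI' a ha haI b hb hbZ
    have e2 := hv d hd hdI t ht htI' c hc hcZ
    have e3 : t ≠ b := fun e => hbZ (e ▸ ht)
    have e4 : t ≠ c := fun e => hcZ (e ▸ ht)
    exact (h _ hle).cv_of_card_lt (by omega) b (hmono hb) hbZ c (hmono hc) hcZ t ht htI (by omega)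
  · have hac := hv b hb hbZ c hc hcZ a ha haI
    have hda : d < a := by
      have hbd := hv b hb hbZ c hc hcZ d hd hdI
      have e1 : d ≠ b := fun e => hbZ (e ▸ hd)
      have e2 : a ≠ c := fun e => hcZ (e ▸ ha)
      omega
    have hcins : #((Z.erase a).erase d) + 2 = #Z := by
      have := card_erase_add_one ha
      have := card_erase_add_one (mem_erase.2 ⟨hda.ne, hd⟩)
      omega
    have hle : #Z - 1 ≤ n := by omega
    have hc1 := card_lowerSet hω hle
    have hmono := lowerSet_mono (n := n) (ω := ω) (show #Z - 1 ≤ k by omega)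
    have haI' : a ∉ lowerSet n ω (#Z - 1) := fun hh => haI (hmono hh)
    have hdI' : d ∉ lowerSet n ω (#Z - 1) := fun hh => hdI (hmono hh)
    obtain ⟨t, ht, htZ⟩ : ∃ t ∈ lowerSet n ω (#Z - 1), t ∉ Z := by
      by_contra! hcon
      have := card_le_card (show lowerSet n ω (#Z - 1) ⊆ (Z.erase a).erase d from fun x hx =>
        mem_erase.2 ⟨fun e => hdI' (e ▸ hx), mem_erase.2 ⟨fun e => haI' (e ▸ hx), hcon x hx⟩⟩)
      omega
    have e1 := hv t (hmono ht) htZ c hc hcZ d hd hdI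
    have e2 := hv b hb hbZ t (hmono ht) htZ a ha haI
    have e3 : t ≠ a := fun e => htZ (e ▸ ha)
    have e4 : t ≠ d := fun e => htZ (e ▸ hd)
    exact (h _ hle).symm.cv_of_card_lt (by omega) d hd hdI' a ha haI' t ht htZ (by omega)

lemma mem_domain_or_opp (hω : Set.BijOn ω (Set.Icc 1 n) (Set.Icc 1 n)) {Z : Finset ℕ}
    (hZ : Z ⊆ Icc 1 n) (h : ∀ k ≤ n, WSep Z (lowerSet n ω k)) :
    Z ∈ ChamberDomain n ω ∨ Z ∈ OppDomain n ω := by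
  have hm : ∀ i ∈ Icc 1 n, ω i ≤ n := fun i hi => (hω.mapsTo (by simpa using hi)).2
  by_contra! hcon
  obtain ⟨h1, h2⟩ := hcon
  simp only [ChamberDomain, OppDomain, Set.mem_ofPred_eq, hZ, true_and] at h1 h2
  push Not at h1 h2
  obtain ⟨i, hi, j, hj, hij, hlt, hjZ, hiZ⟩ := h1
  obtain ⟨p, hp, q, hq, hpq, hlt', hpZ, hqZ⟩ := h2
  have hI : ∀ x ∈ Icc 1 n, ∀ k, (x ∈ lowerSet n ω k ↔ ω x ≤ k) := fun x hx k => by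
    simp [mem_lowerSet, mem_Icc.1 hx]
  have hk := (ld_or_ld_lowerSet hω hZ h (hm i hi)).resolve_left fun hh => by
    have := hh j hjZ (by rw [hI j hj]; omega) i (by rw [hI i hi]) hiZ
    omega
  have hk' := (ld_or_ld_lowerSet hω hZ h (hm q hq)).resolve_right fun hh => by
    have := hh q (by rw [hI q hq]) hqZ p hpZ (by rw [hI p hp]; omega)
    omega
  rcases le_or_gt (ω i) (ω q) with hle | hle
  · have e1 := hk' p hpZ (by rw [hI p hp]; omega) i (by rwa [hI i hi]) hiZ
    have e2 := hk i (by rw [hI i hi]) hiZ p hpZ (by rw [hI p hp]; omega)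
    omega
  · have e1 := hk q (by rw [hI q hq]; omega) hqZ j hjZ (by rw [hI j hj]; omega)
    have e2 := hk' j hjZ (by rw [hI j hj]; omega) q (by rw [hI q hq]) hqZ
    omega

lemma card_lowerSets (hω : Set.BijOn ω (Set.Icc 1 n) (Set.Icc 1 n)) :
    #((range (n + 1)).image (lowerSet n ω)) = n + 1 := by
  rw [card_image_of_injOn, card_range]
  intro k hk l hl e
  rw [← card_lowerSet hω (k := k) (by simpa [Nat.lt_succ_iff] using hk), e,
    card_lowerSet hω (by simpa [Nat.lt_succ_iff] using hl)]

/-- A weakly separated collection of chamber sets with `|Inv(ω)| + n + 1` members. -/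
lemma exists_wsep_domain (hω : Set.BijOn ω (Set.Icc 1 n) (Set.Icc 1 n)) :
    ∃ F : Finset (Finset ℕ), (∀ X ∈ F, X ∈ ChamberDomain n ω) ∧ (∀ X ∈ F, ∀ Y ∈ F, WSep X Y) ∧
      #F = #(InvPairs n ω) + n + 1 := by
  have hm : ∀ i ∈ Icc 1 n, 1 ≤ ω i := fun i hi => (hω.mapsTo (by simpa using hi)).1
  have hinv : ∀ p ∈ InvPairs n ω, p.1 ∈ Icc 1 n ∧ p.2 ∈ Icc 1 n ∧ p.1 < p.2 ∧ ω p.2 < ω p.1 := by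
    intro p hp
    simpa [InvPairs, and_assoc] using hp
  set f : ℕ × ℕ → Finset ℕ := fun p => lowerSet n ω (ω p.2) ∪ Icc 1 (p.1 - 1) with hf
  have hfst : ∀ p ∈ InvPairs n ω, p.1 ∉ f p := by
    intro p hp hmem
    obtain ⟨h1, h2, h3, h4⟩ := hinv p hp
    simp only [hf, mem_union, mem_lowerSet, mem_Icc] at hmem h1
    omega
  have hsnd : ∀ p ∈ InvPairs n ω, p.2 ∈ f p := fun p hp =>
    mem_union_left _ (mem_lowerSet.2 ⟨(hinv p hp).2.1, le_rfl⟩)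
  have hform : ∀ X ∈ (range (n + 1)).image (Icc 1) ∪ (InvPairs n ω).image f,
      ∃ k, ∃ t ≤ n, X = lowerSet n ω k ∪ Icc 1 t := by
    intro X hX
    rcases mem_union.1 hX with h | h
    · obtain ⟨t, ht, rfl⟩ := mem_image.1 h
      refine ⟨0, t, by simpa [Nat.lt_succ_iff] using ht, ?_⟩
      have : lowerSet n ω 0 = ∅ := filter_false_of_mem fun i hi => by
        have := hm i hi
        omega
      rw [this, empty_union]
    · obtain ⟨p, hp, rfl⟩ := mem_image.1 h
      have := mem_Icc.1 (hinv p hp).1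
      exact ⟨ω p.2, p.1 - 1, by omega, rfl⟩
  refine ⟨(range (n + 1)).image (Icc 1) ∪ (InvPairs n ω).image f, fun X hX => ?_,
    fun X hX Y hY => ?_, ?_⟩
  · obtain ⟨k, t, ht, rfl⟩ := hform X hX
    exact lowerSet_union_mem k t ht
  · obtain ⟨k, s, -, rfl⟩ := hform X hX
    obtain ⟨l, t, -, rfl⟩ := hform Y hY
    exact wsep_lowerSet_union k l s t
  · rw [card_union_of_disjoint, card_image_of_injOn, card_image_of_injOn, card_range]
    · omega
    · have hle : ∀ p ∈ InvPairs n ω, ∀ q ∈ InvPairs n ω, f p = f q → q.1 ≤ p.1 := by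
        intro p hp q hq e
        by_contra hlt
        refine hfst p hp (e ▸ mem_union_right _ (mem_Icc.2 ?_))
        have := mem_Icc.1 (hinv p hp).1
        omega
      have hle' : ∀ p ∈ InvPairs n ω, ∀ q ∈ InvPairs n ω, f p = f q → ω p.2 ≤ ω q.2 := by
        intro p hp q hq e
        have h1 := hle q hq p hp e.symm
        have h2 := hinv p hp
        have h3 : p.2 ∈ f q := e ▸ hsnd p hp
        simp only [hf, mem_union, mem_lowerSet, mem_Icc] at h3 h2
        have h4 := hle p hp q hq e
        omega
      intro p hp q hq e
      refine Prod.ext (le_antisymm (hle q hq p hp e.symm) (hle p hp q hq e)) ?_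
      refine hω.injOn (by simpa using (hinv p hp).2.1) (by simpa using (hinv q hq).2.1) ?_
      exact le_antisymm (hle' p hp q hq e) (hle' q hq p hp e.symm)
    · intro s _ t _ e
      rw [← card_icc_one s, ← card_icc_one t]
      exact congrArg card e
    · rw [disjoint_left]
      intro X h1 h2
      obtain ⟨t, -, rfl⟩ := mem_image.1 h1
      obtain ⟨p, hp, e⟩ := mem_image.1 h2
      have e1 := hsnd p hp
      have e2 := hfst p hp
      have e3 := hinv p hp
      rw [e, mem_Icc] at e1 e2
      rw [mem_Icc] at e3
      omega

lemma card_add_card_le (hω : Set.BijOn ω (Set.Icc 1 n) (Set.Icc 1 n))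
    {F H : Finset (Finset ℕ)} (hF : ∀ X ∈ F, X ∈ ChamberDomain n ω)
    (hFs : ∀ X ∈ F, ∀ Y ∈ F, WSep X Y) (hH : ∀ X ∈ H, X ∈ OppDomain n ω)
    (hHs : ∀ X ∈ H, ∀ Y ∈ H, WSep X Y) : 2 * (#F + #H) ≤ n * (n + 1) + 2 + 2 * (n + 1) := by
  obtain ⟨M, hM, hsub⟩ := exists_maxW (m := n) (G := F ∪ H)
    (fun X hX => (mem_union.1 hX).elim (fun h => (hF X h).1) fun h => (hH X h).1) (by
      intro X hX Y hY
      rcases mem_union.1 hX with h1 | h1 <;> rcases mem_union.1 hY with h2 | h2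
      · exact hFs X h1 Y h2
      · exact (ld_of_mem_opp hω (hF X h1) (hH Y h2)).wsep
      · exact (ld_of_mem_opp hω (hF Y h2) (hH X h1)).wsep'
      · exact hHs X h1 Y h2)
  have h1 := card_le_card hsub
  have h2 := hM.good.card_eq
  have h3 : #(F ∩ H) ≤ n + 1 := by
    rw [← card_lowerSets hω]
    refine card_le_card fun Z hZ => ?_
    obtain ⟨hZF, hZH⟩ := mem_inter.1 hZ
    obtain ⟨k, hk, rfl⟩ := exists_eq_lowerSet hω (hF Z hZF) (hH Z hZH)
    exact mem_image_of_mem _ (mem_range.2 (by omega))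
  have h4 := card_union_add_card_inter F H
  omega

lemma IsMaxWColl.exists_opp (hω : Set.BijOn ω (Set.Icc 1 n) (Set.Icc 1 n))
    {F : Finset (Finset ℕ)} (hF : IsMaxWColl (ChamberDomain n ω) F) :
    ∃ H : Finset (Finset ℕ), (∀ X ∈ H, X ∈ OppDomain n ω) ∧ (∀ X ∈ H, ∀ Y ∈ H, WSep X Y) ∧
      n * (n + 1) + 2 + 2 * (n + 1) ≤ 2 * (#F + #H) := by
  classical
  obtain ⟨hFD, hFs, hmax⟩ := hF
  have h0 : ∀ X ∈ ChamberDomain n ω, 0 ∉ X := fun X hX => zero_notMem_of_subset hX.1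
  have hFs' : ∀ X ∈ F, ∀ Y ∈ F, WSep X Y := fun X hX Y hY =>
    (weaklySep_iff (h0 X (hFD hX)) (h0 Y (hFD hY))).1 (hFs X hX Y hY)
  have hmax' : ∀ G : Finset (Finset ℕ), ↑G ⊆ ChamberDomain n ω →
      (∀ X ∈ G, ∀ Y ∈ G, WSep X Y) → F ⊆ G → F = G := fun G hG hGs => hmax G hG fun X hX Y hY =>
    (weaklySep_iff (h0 X (hG hX)) (h0 Y (hG hY))).2 (hGs X hX Y hY)
  have hI : (range (n + 1)).image (lowerSet n ω) ⊆ F := by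
    have hIm : ∀ X ∈ (range (n + 1)).image (lowerSet n ω),
        X ∈ ChamberDomain n ω ∧ X ∈ OppDomain n ω := fun X hX => by
      obtain ⟨k, -, rfl⟩ := mem_image.1 hX
      exact ⟨lowerSet_mem k, lowerSet_mem_opp k⟩
    have hU : ∀ X ∈ F ∪ (range (n + 1)).image (lowerSet n ω), X ∈ ChamberDomain n ω :=
      fun X hX => (mem_union.1 hX).elim (fun h => hFD h) fun h => (hIm X h).1
    rw [hmax' (F ∪ (range (n + 1)).image (lowerSet n ω)) (fun X hX => hU X hX) ?_ subset_union_left]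
    · exact subset_union_right
    · intro X hX Y hY
      rcases mem_union.1 hX with h1 | h1
      · rcases mem_union.1 hY with h2 | h2
        · exact hFs' X h1 Y h2
        · exact (ld_of_mem_opp hω (hU X hX) (hIm Y h2).2).wsep
      · exact (ld_of_mem_opp hω (hU Y hY) (hIm X h1).2).wsep'
  obtain ⟨M, hM, hsub⟩ := exists_maxW (m := n) (fun X hX => (hFD hX).1) hFs'
  have hMF : F = M.filter (· ∈ ChamberDomain n ω) :=
    hmax' _ (fun X hX => (mem_filter.1 hX).2)
      (fun X hX Y hY => hM.wsep X (mem_filter.1 hX).1 Y (mem_filter.1 hY).1)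
      fun X hX => mem_filter.2 ⟨hsub hX, hFD hX⟩
  refine ⟨M.filter (· ∈ OppDomain n ω), fun X hX => (mem_filter.1 hX).2,
    fun X hX Y hY => hM.wsep X (mem_filter.1 hX).1 Y (mem_filter.1 hY).1, ?_⟩
  have h1 : M ⊆ F ∪ M.filter (· ∈ OppDomain n ω) := by
    intro Z hZ
    rcases mem_domain_or_opp hω (hM.sub Z hZ) fun k hk => hM.wsep Z hZ _
      (hsub (hI (mem_image_of_mem _ (mem_range.2 (by omega))))) with h | h
    · rw [hMF]
      exact mem_union_left _ (mem_filter.2 ⟨hZ, h⟩)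
    · exact mem_union_right _ (mem_filter.2 ⟨hZ, h⟩)
  have h2 : n + 1 ≤ #(F ∩ M.filter (· ∈ OppDomain n ω)) := by
    rw [← card_lowerSets hω]
    refine card_le_card fun X hX => mem_inter.2 ⟨hI hX, mem_filter.2 ⟨hsub (hI hX), ?_⟩⟩
    obtain ⟨k, -, rfl⟩ := mem_image.1 hX
    exact lowerSet_mem_opp k
  have h3 := card_le_card h1
  have h4 := card_union_add_card_inter F (M.filter (· ∈ OppDomain n ω))
  have h5 := hM.good.card_eq
  omega

lemma IsMaxWColl.card_eq (hω : Set.BijOn ω (Set.Icc 1 n) (Set.Icc 1 n))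
    {F : Finset (Finset ℕ)} (hF : IsMaxWColl (ChamberDomain n ω) F) :
    #F = #(InvPairs n ω) + n + 1 := by
  obtain ⟨H, hH, hHs, hle⟩ := hF.exists_opp hω
  obtain ⟨F₁, hF₁, hF₁s, hc₁⟩ := exists_wsep_domain hω
  obtain ⟨F₂, hF₂, hF₂s, hc₂⟩ := exists_wsep_domain (bijOn_revPerm hω)
  have h1 := card_add_card_le hω hF₁ hF₁s hH hHs
  have h0 : ∀ X ∈ F, 0 ∉ X := fun X hX => zero_notMem_of_subset (hF.1 hX).1
  have h2 := card_add_card_le hω (F := F) (H := F₂.image (cpl n)) (fun X hX => hF.1 hX)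
    (fun X hX Y hY => (weaklySep_iff (h0 X hX) (h0 Y hY)).1 (hF.2.1 X hX Y hY))
    (fun X hX => by
      obtain ⟨Y, hY, rfl⟩ := mem_image.1 hX
      exact cpl_mem_opp hω (hF₂ Y hY))
    (fun X hX Y hY => by
      obtain ⟨X, hX', rfl⟩ := mem_image.1 hX
      obtain ⟨Y, hY', rfl⟩ := mem_image.1 hY
      exact (wsep_cpl (hF₂ X hX').1 (hF₂ Y hY').1).2 (hF₂s X hX' Y hY'))
  rw [card_image_of_injOn fun X hX Y hY e => by
    rw [← cpl_cpl (hF₂ X hX).1, ← cpl_cpl (hF₂ Y hY).1]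
    exact congrArg (cpl n) e] at h2
  have h3 := card_invPairs_add hω
  have h4 : n * (n + 1) = n * n + n := by ring
  omega

end Domains

/-- for every permutation `ω` of `[n]`, the domain `D(ω)` of all
`ω`-chamber sets is w-pure, with w-rank `|Inv(ω)| + n + 1`. -/
theorem chamber_domain_w_pure (n : ℕ) (hn : 1 ≤ n) (ω : ℕ → ℕ)
    (hω : Set.BijOn ω (Set.Icc 1 n) (Set.Icc 1 n)) :
    WPure (ChamberDomain n ω) ∧
    ∀ F : Finset (Finset ℕ), IsMaxWColl (ChamberDomain n ω) F →
      F.card = (InvPairs n ω).card + n + 1 :=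
  ⟨fun _ _ hF hG => (hF.card_eq hω).trans (hG.card_eq hω).symm, fun _ hF => hF.card_eq hω⟩
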